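/- For every positive integer α, the following are equivalent: (i) α ≥ 4 and α ∉ {5, 7, 13, 17}; (ii) there exist a positive integer β and integers a, b, c such that β²·(b² − 4ac) = α² + 4 and for all integers (x, y) ≠ (0, 0) the value 2a·x² + 2b·x·y + 2c·y² is neither 0 nor −2. -/

import Mathlib

namespace Yokoi

open Finset Filter Topology

/-! ### Summation of smooth functions against periodic weights -/

/-- A chain of functions, each the derivative of the previous one. -/
structure DerivChain (F₀ F₁ F₂ F₃ : ℝ → ℝ) : Prop where
  d₀ : ∀ x, HasDerivAt F₀ (F₁ x) x
  d₁ : ∀ x, HasDerivAt F₁ (F₂ x) x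
  d₂ : ∀ x, HasDerivAt F₂ (F₃ x) x

theorem abs_le_of_hasDerivAt {h h' : ℝ → ℝ} {a K : ℝ} (hd : ∀ x, HasDerivAt h (h' x) x)
    (hb : ∀ x ∈ Set.Icc a (a + 1), |h' x| ≤ K) (h0 : h a = 0) :
    ∀ x ∈ Set.Icc a (a + 1), |h x| ≤ K := by
  intro x hx
  have hK : 0 ≤ K := (abs_nonneg _).trans (hb x hx)
  have := (convex_Icc a (a + 1)).norm_image_sub_le_of_norm_hasDerivWithin_le
    (fun y _ => (hd y).hasDerivWithinAt) (fun y hy => by simpa using hb y hy)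
    (Set.left_mem_Icc.2 (by linarith)) hx
  rw [h0, sub_zero, Real.norm_eq_abs, Real.norm_eq_abs] at this
  refine this.trans (mul_le_of_le_one_right hK ?_)
  rw [abs_le]
  constructor <;> linarith [hx.1, hx.2]

theorem taylor_step {F₀ F₁ F₂ F₃ Φ : ℝ → ℝ} {a c K : ℝ} (hF : DerivChain F₀ F₁ F₂ F₃)
    (hΦ : ∀ x, HasDerivAt Φ (c * F₀ x) x) (hK : ∀ x ∈ Set.Icc a (a + 1), |F₃ x| ≤ K) :
    |F₂ (a + 1) - F₂ a| ≤ K ∧ |F₁ (a + 1) - F₁ a - F₂ a| ≤ K ∧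
      |F₀ (a + 1) - F₀ a - F₁ a - F₂ a / 2| ≤ K ∧
      |Φ (a + 1) - Φ a - c * (F₀ a + F₁ a / 2 + F₂ a / 6)| ≤ |c| * K := by
  have mem : a + 1 ∈ Set.Icc a (a + 1) := Set.right_mem_Icc.2 (by linarith)
  have e₂ : ∀ x ∈ Set.Icc a (a + 1), |F₂ x - F₂ a| ≤ K :=
    abs_le_of_hasDerivAt (fun x => (hF.d₂ x).sub_const _) hK (by ring)
  have e₁ : ∀ x ∈ Set.Icc a (a + 1), |F₁ x - F₁ a - F₂ a * (x - a)| ≤ K :=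
    abs_le_of_hasDerivAt (h' := fun x => F₂ x - F₂ a)
      (fun x => (((hF.d₁ x).sub_const _).sub
        (((hasDerivAt_id x).sub_const a).const_mul (F₂ a))).congr_deriv (by simp)) e₂ (by ring)
  have e₀ : ∀ x ∈ Set.Icc a (a + 1),
      |F₀ x - F₀ a - F₁ a * (x - a) - F₂ a * ((x - a) ^ 2 / 2)| ≤ K :=
    abs_le_of_hasDerivAt (h' := fun x => F₁ x - F₁ a - F₂ a * (x - a))
      (fun x => ((((hF.d₀ x).sub_const _).sub
        (((hasDerivAt_id x).sub_const a).const_mul (F₁ a))).sub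
        (((((hasDerivAt_id x).sub_const a).pow 2).div_const 2).const_mul (F₂ a))).congr_deriv
          (by simp)) e₁ (by ring)
  have eΦ : ∀ x ∈ Set.Icc a (a + 1),
      |Φ x - Φ a - c * (F₀ a * (x - a) + F₁ a * ((x - a) ^ 2 / 2)
        + F₂ a * ((x - a) ^ 3 / 6))| ≤ |c| * K :=
    abs_le_of_hasDerivAt
      (h' := fun x => c * (F₀ x - F₀ a - F₁ a * (x - a) - F₂ a * ((x - a) ^ 2 / 2)))
      (fun x => (((hΦ x).sub_const _).sub
        (((((hasDerivAt_id x).sub_const a).const_mul (F₀ a)).add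
        (((((hasDerivAt_id x).sub_const a).pow 2).div_const 2).const_mul (F₁ a))).add
        (((((hasDerivAt_id x).sub_const a).pow 3).div_const 6).const_mul (F₂ a))
          |>.const_mul c)).congr_deriv (by simp; ring))
      (fun x hx => by rw [abs_mul]; exact mul_le_mul_of_nonneg_left (e₀ x hx) (abs_nonneg _))
      (by ring)
  refine ⟨e₂ _ mem, ?_, ?_, ?_⟩
  · convert e₁ _ mem using 2; ring
  · convert e₀ _ mem using 2; ring
  · convert eΦ _ mem using 2; ring

/-- The first Bernoulli polynomial, rescaled to the interval `[0, q]`. -/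
noncomputable def β₁ (q : ℕ) (x : ℝ) : ℝ := x / q - 1 / 2

/-- An antiderivative of `β₁`, a multiple of the second Bernoulli polynomial. -/
noncomputable def β₂ (q : ℕ) (x : ℝ) : ℝ := x ^ 2 / (2 * q) - x / 2 + q / 12

/-- An antiderivative of `β₂`. -/
noncomputable def β₃ (q : ℕ) (x : ℝ) : ℝ := x ^ 3 / (6 * q) - x ^ 2 / 4 + q * x / 12

/-- The mean value of a `q`-periodic function. -/
noncomputable def mean (q : ℕ) (p : ℤ → ℝ) : ℝ := (∑ i ∈ range q, p i) / q

/-- The sum of `b` against one period of `p` starting at `M`. -/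
noncomputable def shiftSum (q : ℕ) (b : ℝ → ℝ) (p : ℤ → ℝ) (M : ℤ) : ℝ :=
  ∑ i ∈ range q, p (M + i) * b i

/-- The boundary coefficient of order one, with the periodic first Bernoulli function
normalised to vanish at the integers. -/
noncomputable def edge (q : ℕ) (p : ℤ → ℝ) (M : ℤ) : ℝ := shiftSum q (β₁ q) p M + p M / 2

theorem shiftSum_succ {q : ℕ} {p : ℤ → ℝ} (hp : Function.Periodic p q) (b : ℝ → ℝ) (M : ℤ) :
    shiftSum q b p (M + 1) - shiftSum q b p M =
      ∑ i ∈ range q, p (M + i) * (b (i - 1) - b i) + p M * (b (q - 1) - b (-1)) := by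
  have h := sum_range_succ' (fun i : ℕ => p (M + i) * b ((i : ℝ) - 1)) q
  rw [sum_range_succ] at h
  have h1 : ∀ i : ℕ, p (M + ((i + 1 : ℕ) : ℤ)) * b (((i + 1 : ℕ) : ℝ) - 1)
      = p (M + 1 + i) * b i := by
    intro i
    push_cast
    congr 2 <;> ring
  simp only [h1] at h
  simp only [shiftSum, mul_sub, sum_sub_distrib]
  rw [show p (M + q) = p M from hp M] at h
  simp at h
  linarith

theorem sum_shift {q : ℕ} {p : ℤ → ℝ} (hp : Function.Periodic p q) (M : ℕ) :
    ∑ i ∈ range q, p (M + i) = ∑ i ∈ range q, p i := by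
  induction M with
  | zero => simp
  | succ M ih =>
    have := shiftSum_succ hp (fun _ => 1) M
    simp only [shiftSum, mul_one, sub_self, mul_zero, sum_const_zero, add_zero] at this
    push_cast
    linarith

theorem abs_shiftSum_le {q : ℕ} {p : ℤ → ℝ} {B : ℝ} (hB : ∀ i, |p i| ≤ B) (b : ℝ → ℝ) (M : ℤ) :
    |shiftSum q b p M| ≤ B * ∑ i ∈ range q, |b i| := by
  rw [mul_sum]
  refine (abs_sum_le_sum_abs _ _).trans (sum_le_sum fun i _ => ?_)
  rw [abs_mul]
  exact mul_le_mul_of_nonneg_right (hB _) (abs_nonneg _)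

theorem edge_succ {q : ℕ} (hq : 0 < q) {p : ℤ → ℝ} (hp : Function.Periodic p q) (M : ℕ) :
    edge q p (M + 1) - edge q p M = (p M + p (M + 1)) / 2 - mean q p ∧
    shiftSum q (β₂ q) p (M + 1) - shiftSum q (β₂ q) p M =
      p (M + 1) / 2 - mean q p / 2 - edge q p (M + 1) ∧
    shiftSum q (β₃ q) p (M + 1) - shiftSum q (β₃ q) p M =
      p (M + 1) / 4 - mean q p / 6 - edge q p (M + 1) / 2 - shiftSum q (β₂ q) p (M + 1) := by
  have hq' : (q : ℝ) ≠ 0 := by positivity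
  have hs := sum_shift hp M
  have hm : ∑ i ∈ range q, p (M + i) * (1 / q : ℝ) = mean q p := by
    rw [← sum_mul, hs, mean]; ring
  have h1 : shiftSum q (β₁ q) p (M + 1) - shiftSum q (β₁ q) p M = - mean q p + p M := by
    rw [shiftSum_succ hp, ← hm, ← sum_neg_distrib]
    congr 1
    · refine sum_congr rfl fun i _ => ?_
      simp only [β₁]; field_simp; ring
    · simp only [β₁]; field_simp; ring
  have h2 : shiftSum q (β₂ q) p (M + 1) - shiftSum q (β₂ q) p M =
      - shiftSum q (β₁ q) p M + mean q p / 2 - p M := by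
    rw [shiftSum_succ hp, ← hm, sum_div, shiftSum, ← sum_neg_distrib, ← sum_add_distrib,
        sub_eq_add_neg]
    congr 1
    · refine sum_congr rfl fun i _ => ?_
      simp only [β₁, β₂]; field_simp; ring
    · simp only [β₂]; field_simp; ring
  have h3 : shiftSum q (β₃ q) p (M + 1) - shiftSum q (β₃ q) p M =
      - shiftSum q (β₂ q) p M + shiftSum q (β₁ q) p M / 2 - mean q p / 6 + p M / 2 := by
    rw [shiftSum_succ hp, ← hm, sum_div, shiftSum, shiftSum, sum_div, ← sum_neg_distrib,
      ← sum_add_distrib, ← sum_sub_distrib]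
    congr 1
    · refine sum_congr rfl fun i _ => ?_
      simp only [β₁, β₂, β₃]; field_simp; ring
    · simp only [β₃]; field_simp; ring
  simp only [edge]
  refine ⟨?_, ?_, ?_⟩ <;> linarith

theorem euler_maclaurin {q : ℕ} (hq : 0 < q) {B : ℝ} (hB0 : 0 ≤ B) : ∃ C, 0 ≤ C ∧
    ∀ p : ℤ → ℝ, Function.Periodic p q → (∀ i, |p i| ≤ B) →
      (∀ M, |edge q p M| ≤ C ∧ |shiftSum q (β₂ q) p M| ≤ C ∧ |shiftSum q (β₃ q) p M| ≤ C) ∧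
      ∀ F₀ F₁ F₂ F₃ Φ : ℝ → ℝ, DerivChain F₀ F₁ F₂ F₃ →
        (∀ x, HasDerivAt Φ (mean q p * F₀ x) x) → ∀ (M : ℕ) (K : ℕ → ℝ),
        (∀ j < M, ∀ x ∈ Set.Icc (j : ℝ) (j + 1), |F₃ x| ≤ K j) →
        |∑ j ∈ range M, (p j * F₀ j + p (j + 1) * F₀ (j + 1)) / 2 - (Φ M - Φ 0)
          - (edge q p M * F₀ M - edge q p 0 * F₀ 0)
          - (shiftSum q (β₂ q) p M * F₁ M - shiftSum q (β₂ q) p 0 * F₁ 0)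
          - (shiftSum q (β₃ q) p M * F₂ M - shiftSum q (β₃ q) p 0 * F₂ 0)|
          ≤ C * ∑ j ∈ range M, K j := by
  set c₁ := B * ∑ i ∈ range q, |β₁ q i| + B with hc₁
  set c₂ := B * ∑ i ∈ range q, |β₂ q i|
  set c₃ := B * ∑ i ∈ range q, |β₃ q i|
  have n₁ : 0 ≤ c₁ := by positivity
  have n₂ : 0 ≤ c₂ := by positivity
  have n₃ : 0 ≤ c₃ := by positivity
  refine ⟨2 * B + c₁ + c₂ + c₃, by positivity, fun p hp hB => ?_⟩
  have b₁ : ∀ M, |edge q p M| ≤ c₁ := by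
    intro M
    refine (abs_add_le _ _).trans (add_le_add (abs_shiftSum_le hB _ _) ?_)
    rw [abs_div, abs_two]
    linarith [hB M, abs_nonneg (p M)]
  have b₂ : ∀ M, |shiftSum q (β₂ q) p M| ≤ c₂ := abs_shiftSum_le hB _
  have b₃ : ∀ M, |shiftSum q (β₃ q) p M| ≤ c₃ := abs_shiftSum_le hB _
  have bm : |mean q p| ≤ B := by
    rw [mean, abs_div, Nat.abs_cast, div_le_iff₀ (by positivity)]
    calc _ ≤ ∑ i ∈ range q, |p i| := abs_sum_le_sum_abs _ _
      _ ≤ ∑ _i ∈ range q, B := sum_le_sum fun i _ => hB i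
      _ = B * q := by simp [mul_comm]
  refine ⟨fun M => ⟨by linarith [b₁ M], by linarith [b₂ M], by linarith [b₃ M]⟩, ?_⟩
  intro F₀ F₁ F₂ F₃ Φ hF hΦ M K hK
  induction M with
  | zero => simp
  | succ M ih =>
    obtain ⟨t₂, t₁, t₀, tΦ⟩ := taylor_step hF hΦ (hK M (by omega))
    obtain ⟨r₁, r₂, r₃⟩ := edge_succ hq hp M
    have ih' := ih fun j hj => hK j (by omega)
    have hKM : 0 ≤ K M := (abs_nonneg _).trans t₂
    rw [sum_range_succ, sum_range_succ, mul_add]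
    push_cast
    set e₂ := F₂ (M + 1) - F₂ M
    set e₁ := F₁ (M + 1) - F₁ M - F₂ M with he₁
    set e₀ := F₀ (M + 1) - F₀ M - F₁ M - F₂ M / 2 with he₀
    set eΦ := Φ (M + 1) - Φ M - mean q p * (F₀ M + F₁ M / 2 + F₂ M / 6) with heΦ
    have key : ∀ x y P : ℝ, |x| ≤ P → |y| ≤ K M → |x * y| ≤ P * K M := fun x y P hx hy => by
      rw [abs_mul]; exact mul_le_mul hx hy (abs_nonneg _) ((abs_nonneg _).trans hx)
    have k₀ := key (p (M + 1)) e₀ B (hB _) t₀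
    have k₁ := key _ e₀ _ (b₁ (M + 1)) t₀
    have k₂ := key _ e₁ _ (b₂ (M + 1)) t₁
    have k₃ := key _ e₂ _ (b₃ (M + 1)) t₂
    have kΦ : |eΦ| ≤ B * K M := tΦ.trans (mul_le_mul_of_nonneg_right bm hKM)
    have hstep : (p M * F₀ M + p (M + 1) * F₀ (M + 1)) / 2 - (Φ (M + 1) - Φ M)
        - (edge q p (M + 1) * F₀ (M + 1) - edge q p M * F₀ M)
        - (shiftSum q (β₂ q) p (M + 1) * F₁ (M + 1) - shiftSum q (β₂ q) p M * F₁ M)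
        - (shiftSum q (β₃ q) p (M + 1) * F₂ (M + 1) - shiftSum q (β₃ q) p M * F₂ M)
        = p (M + 1) * e₀ / 2 - eΦ - edge q p (M + 1) * e₀ - shiftSum q (β₂ q) p (M + 1) * e₁
          - shiftSum q (β₃ q) p (M + 1) * e₂ := by
      have s₁ : edge q p M = edge q p (M + 1) - ((p M + p (M + 1)) / 2 - mean q p) := by linarith
      have s₂ : shiftSum q (β₂ q) p M = shiftSum q (β₂ q) p (M + 1) -
        (p (M + 1) / 2 - mean q p / 2 - edge q p (M + 1)) := by linarith
      have s₃ : shiftSum q (β₃ q) p M = shiftSum q (β₃ q) p (M + 1) -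
        (p (M + 1) / 4 - mean q p / 6 - edge q p (M + 1) / 2 - shiftSum q (β₂ q) p (M + 1)) := by
        linarith
      rw [s₁, s₂, s₃, he₁, he₀, heΦ]
      ring
    simp only [abs_le] at *
    constructor <;> linarith [k₀.1, k₀.2, k₁.1, k₁.2, k₂.1, k₂.2, k₃.1, k₃.2,
        kΦ.1, kΦ.2, ih'.1, ih'.2]

theorem geom_bound {u : ℝ} (hu : 0 < u) (hu1 : u ≤ 1) (M : ℕ) :
    ∑ j ∈ range M, Real.exp (-(u * j)) ≤ 2 / u := by
  have h1 : Real.exp (-u) ≤ 1 - u / 2 := by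
    have h2 : Real.exp (-u) * (1 + u) ≤ 1 := by
      calc Real.exp (-u) * (1 + u) ≤ Real.exp (-u) * Real.exp u :=
            mul_le_mul_of_nonneg_left (by linarith [Real.add_one_le_exp u]) (Real.exp_nonneg _)
        _ = 1 := by rw [← Real.exp_add]; simp
    have h3 : (1 - u / 2) * (1 + u) ≥ 1 := by nlinarith
    exact le_of_mul_le_mul_right (h2.trans h3) (by linarith)
  have h : ∀ M : ℕ, ∑ j ∈ range M, Real.exp (-(u * j)) ≤ 2 / u * (1 - Real.exp (-(u * M))) := by
    intro M
    induction M with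
    | zero => simp
    | succ M ih =>
      rw [sum_range_succ]
      have : Real.exp (-(u * (M + 1 : ℕ))) = Real.exp (-(u * M)) * Real.exp (-u) := by
        rw [← Real.exp_add]; push_cast; ring_nf
      rw [this]
      have h4 : Real.exp (-(u * M)) ≤ 2 / u * (Real.exp (-(u * M)) * (1 - Real.exp (-u))) := by
        rw [div_mul_eq_mul_div, le_div_iff₀ hu]
        nlinarith [Real.exp_pos (-(u * M))]
      linarith
  refine (h M).trans ?_
  have : 0 ≤ 2 / u * Real.exp (-(u * M)) := by positivity
  linarith

theorem summable_exp_neg_mul {u : ℝ} (hu : 0 < u) :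
    Summable fun j : ℕ => Real.exp (-(u * j)) := by
  have := Real.summable_exp_nat_mul_of_ge (c := -u) (by linarith)
      (f := fun j => (j : ℝ)) (fun i => le_rfl)
  simpa using this

theorem tendsto_exp_neg_mul {u : ℝ} (hu : 0 < u) :
    Tendsto (fun j : ℕ => Real.exp (-(u * j))) atTop (𝓝 0) :=
  (summable_exp_neg_mul hu).tendsto_atTop_zero

theorem exists_periodic_bound {q : ℕ} (hq : 0 < q) {p : ℤ → ℝ} (hp : Function.Periodic p q) :
    ∃ B, 0 ≤ B ∧ ∀ i, |p i| ≤ B := by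
  refine ⟨∑ i ∈ range q, |p i|, by positivity, fun i => ?_⟩
  have h0 := Int.emod_nonneg i (b := q) (by positivity)
  have h1 := Int.emod_lt_of_pos i (b := q) (by positivity)
  have h2 : p i = p ((i % q).toNat : ℕ) := by
    have h3 : i = i % q + (i / q) * q := by have := Int.emod_add_mul_ediv i q; linarith
    have h4 := (hp.int_mul (i / q)) (i % q)
    rw [Int.toNat_of_nonneg h0, ← h4]
    congr 1
  rw [h2]
  exact single_le_sum (f := fun j : ℕ => |p j|) (fun _ _ => abs_nonneg _) (mem_range.2 (by omega))

/-- Exponential decay of a chain of derivatives on the positive half line. -/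
structure Decays (A : ℝ) (G₀ G₁ G₂ G₃ : ℝ → ℝ) : Prop where
  a₀ : ∀ x, 0 ≤ x → |G₀ x| ≤ A * Real.exp (-x)
  a₁ : ∀ x, 0 ≤ x → |G₁ x| ≤ A * Real.exp (-x)
  a₂ : ∀ x, 0 ≤ x → |G₂ x| ≤ A * Real.exp (-x)
  a₃ : ∀ x, 0 ≤ x → |G₃ x| ≤ A * Real.exp (-x)

theorem DerivChain.comp_mul {G₀ G₁ G₂ G₃ : ℝ → ℝ} (hG : DerivChain G₀ G₁ G₂ G₃) (u : ℝ) :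
    DerivChain (fun x => G₀ (u * x)) (fun x => u * G₁ (u * x)) (fun x => u ^ 2 * G₂ (u * x))
      (fun x => u ^ 3 * G₃ (u * x)) := by
  have hl : ∀ x, HasDerivAt (fun x : ℝ => u * x) u x := fun x => by
    simpa using (hasDerivAt_id x).const_mul u
  exact ⟨fun x => ((hG.d₀ _).comp x (hl x)).congr_deriv (by ring),
    fun x => (((hG.d₁ _).comp x (hl x)).const_mul u).congr_deriv (by ring),
    fun x => (((hG.d₂ _).comp x (hl x)).const_mul (u ^ 2)).congr_deriv (by ring)⟩

theorem euler_maclaurin_tsum {q : ℕ} (hq : 0 < q) {p : ℤ → ℝ} (hp : Function.Periodic p q)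
    {G₀ G₁ G₂ G₃ Φ : ℝ → ℝ} (hG : DerivChain G₀ G₁ G₂ G₃) {A Φ' : ℝ} (hA : Decays A G₀ G₁ G₂ G₃)
    (hΦ : ∀ x, HasDerivAt Φ (mean q p * G₀ x) x) (hΦ' : Tendsto Φ atTop (𝓝 Φ')) :
    ∃ C, ∀ u, 0 < u → u ≤ 1 → Summable (fun j : ℕ => p j * G₀ (u * j)) ∧
      |∑' j : ℕ, p j * G₀ (u * j) - p 0 * G₀ 0 / 2 - (Φ' - Φ 0) / u + edge q p 0 * G₀ 0
        + u * (shiftSum q (β₂ q) p 0 * G₁ 0)| ≤ C * u ^ 2 := by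
  obtain ⟨B, hB0, hB⟩ := exists_periodic_bound hq hp
  obtain ⟨C, hC0, hC⟩ := euler_maclaurin hq hB0
  obtain ⟨hb, hem⟩ := hC p hp hB
  have hA0 : 0 ≤ A := by
    have := (abs_nonneg _).trans (hA.a₀ 0 le_rfl)
    simpa using this
  refine ⟨C * (A * 2) + C * A, fun u hu hu1 => ?_⟩
  have hsum : Summable (fun j : ℕ => p j * G₀ (u * j)) := by
    refine Summable.of_norm_bounded ((summable_exp_neg_mul hu).mul_left (B * A)) fun j => ?_
    rw [Real.norm_eq_abs, abs_mul, mul_assoc]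
    exact mul_le_mul (hB _) (hA.a₀ _ (by positivity)) (abs_nonneg _) hB0
  refine ⟨hsum, ?_⟩
  have hΦu : ∀ x, HasDerivAt (fun x => Φ (u * x) / u) (mean q p * G₀ (u * x)) x := fun x => by
    have hl : HasDerivAt (fun x : ℝ => u * x) u x := by
      simpa using (hasDerivAt_id x).const_mul u
    exact (((hΦ _).comp x hl).div_const u).congr_deriv (by field_simp)
  have hM : ∀ M : ℕ, _ := fun M => hem _ _ _ _ _ (hG.comp_mul u) hΦu M
    (fun j => u ^ 3 * A * Real.exp (-(u * j))) (fun j _ x hx => by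
      rw [abs_mul, abs_of_pos (by positivity), mul_assoc]
      refine mul_le_mul_of_nonneg_left ((hA.a₃ _ (mul_nonneg hu.le
          (by linarith [hx.1, (Nat.cast_nonneg j : (0:ℝ) ≤ j)]))).trans ?_) (by positivity)
      refine mul_le_mul_of_nonneg_left (Real.exp_le_exp.2 ?_) hA0
      nlinarith [hx.1])
  have htrap : ∀ M : ℕ, ∑ j ∈ range M, (p j * G₀ (u * j) + p (j + 1) * G₀ (u * (j + 1))) / 2 =
      ∑ j ∈ range M, p j * G₀ (u * j) - p 0 * G₀ 0 / 2 + p M * G₀ (u * M) / 2 := by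
    intro M
    induction M with
    | zero => simp
    | succ M ih => rw [sum_range_succ, ih, sum_range_succ]; push_cast; ring
  have hdec : ∀ (G : ℝ → ℝ) (c : ℕ → ℝ) (K : ℝ), (∀ x, 0 ≤ x → |G x| ≤ A * Real.exp (-x)) →
      (∀ M, |c M| ≤ K) → Tendsto (fun M : ℕ => c M * G (u * M)) atTop (𝓝 0) := by
    intro G c K hGb hc
    have h0 : Tendsto (fun M : ℕ => K * (A * Real.exp (-(u * M)))) atTop (𝓝 0) := by
      simpa using ((tendsto_exp_neg_mul hu).const_mul A).const_mul K
    refine squeeze_zero_norm (fun M => ?_) h0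
    rw [Real.norm_eq_abs, abs_mul]
    exact mul_le_mul (hc M) (hGb _ (by positivity)) (abs_nonneg _) ((abs_nonneg _).trans (hc M))
  have l0 := hdec G₀ (fun M => p M) B hA.a₀ (fun M => hB M)
  have l1 := hdec G₀ (fun M => edge q p M) C hA.a₀ (fun M => (hb M).1)
  have l2 := hdec G₁ (fun M => shiftSum q (β₂ q) p M) C hA.a₁ (fun M => (hb M).2.1)
  have l3 := hdec G₂ (fun M => shiftSum q (β₃ q) p M) C hA.a₂ (fun M => (hb M).2.2)
  have lΦ : Tendsto (fun M : ℕ => Φ (u * M) / u) atTop (𝓝 (Φ' / u)) :=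
    (hΦ'.comp (tendsto_natCast_atTop_atTop.const_mul_atTop hu)).div_const u
  have lim := (((((hsum.hasSum.tendsto_sum_nat.sub_const (p 0 * G₀ 0 / 2)).add (l0.div_const 2)).sub
    (lΦ.sub_const (Φ (u * 0) / u))).sub (l1.sub_const (edge q p 0 * G₀ (u * 0)))).sub
    ((l2.const_mul u).sub_const (shiftSum q (β₂ q) p 0 * (u * G₁ (u * 0))))).sub
    ((l3.const_mul (u ^ 2)).sub_const (shiftSum q (β₃ q) p 0 * (u ^ 2 * G₂ (u * 0))))
  have main : |∑' j : ℕ, p j * G₀ (u * j) - p 0 * G₀ 0 / 2 + 0 / 2 - (Φ' / u - Φ (u * 0) / u)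
      - (0 - edge q p 0 * G₀ (u * 0)) - (u * 0 - shiftSum q (β₂ q) p 0 * (u * G₁ (u * 0)))
      - (u ^ 2 * 0 - shiftSum q (β₃ q) p 0 * (u ^ 2 * G₂ (u * 0)))| ≤ C * (A * 2) * u ^ 2 := by
    refine le_of_tendsto lim.abs (Eventually.of_forall fun M => ?_)
    have h := hM M
    rw [htrap] at h
    have e : C * ∑ j ∈ range M, u ^ 3 * A * Real.exp (-(u * j)) ≤ C * (A * 2) * u ^ 2 := by
      rw [← mul_sum]
      calc C * (u ^ 3 * A * ∑ j ∈ range M, Real.exp (-(u * j))) ≤ C * (u ^ 3 * A * (2 / u)) :=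
            mul_le_mul_of_nonneg_left (mul_le_mul_of_nonneg_left (geom_bound hu hu1 M)
              (by positivity)) hC0
        _ = _ := by field_simp
    refine le_trans (le_of_eq ?_) (h.trans e)
    congr 1
    ring
  have h3 : |shiftSum q (β₃ q) p 0 * G₂ 0| ≤ C * A := by
    rw [abs_mul]
    refine mul_le_mul (hb 0).2.2 ?_ (abs_nonneg _) hC0
    simpa using hA.a₂ 0 le_rfl
  have h4 : |u ^ 2 * (shiftSum q (β₃ q) p 0 * G₂ 0)| ≤ C * A * u ^ 2 := by
    rw [abs_mul, abs_of_nonneg (by positivity), mul_comm]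
    exact mul_le_mul_of_nonneg_right h3 (by positivity)
  simp only [mul_zero] at main
  rw [abs_le] at *
  rw [sub_div]
  constructor <;> linarith [main.1, main.2, h4.1, h4.2]

/-! ### Gaussian estimates -/

theorem pow_mul_exp_neg_sq_le {x : ℝ} (hx : 0 ≤ x) (k : ℕ) :
    x ^ k * Real.exp (-x ^ 2) ≤ k.factorial * 3 * Real.exp (-x) := by
  have h1 : x ^ k ≤ k.factorial * Real.exp x := by
    have := Real.pow_div_factorial_le_exp x hx k
    rwa [div_le_iff₀' (by positivity)] at this
  have h2 : Real.exp (-x ^ 2) ≤ 3 * (Real.exp (-x) * Real.exp (-x)) := by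
    calc Real.exp (-x ^ 2) ≤ Real.exp (1 + (-x + -x)) :=
          Real.exp_le_exp.2 (by nlinarith [sq_nonneg (x - 1)])
      _ = Real.exp 1 * (Real.exp (-x) * Real.exp (-x)) := by rw [Real.exp_add, Real.exp_add]
      _ ≤ _ := by
        have := Real.exp_one_lt_d9
        exact mul_le_mul_of_nonneg_right (by linarith) (by positivity)
  calc x ^ k * Real.exp (-x ^ 2) ≤
      (k.factorial * Real.exp x) * (3 * (Real.exp (-x) * Real.exp (-x))) := by gcongr
    _ = k.factorial * 3 * Real.exp (-x) * (Real.exp x * Real.exp (-x)) := by ring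
    _ = _ := by rw [← Real.exp_add]; simp

theorem hasDerivAt_gauss (x : ℝ) :
    HasDerivAt (fun x : ℝ => Real.exp (-x ^ 2)) (-2 * x * Real.exp (-x ^ 2)) x :=
  (((hasDerivAt_id x).pow 2).neg.exp).congr_deriv (by simp; ring)

theorem hasDerivAt_poly_mul_gauss {P P' : ℝ → ℝ} {x : ℝ} (hP : HasDerivAt P (P' x) x) :
    HasDerivAt (fun x : ℝ => P x * Real.exp (-x ^ 2))
      ((P' x - 2 * x * P x) * Real.exp (-x ^ 2)) x :=
  (hP.mul (hasDerivAt_gauss x)).congr_deriv (by ring)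

theorem derivChain_gauss : DerivChain (fun x => Real.exp (-x ^ 2))
    (fun x => -2 * x * Real.exp (-x ^ 2)) (fun x => (4 * x ^ 2 - 2) * Real.exp (-x ^ 2))
    (fun x => (-8 * x ^ 3 + 12 * x) * Real.exp (-x ^ 2)) := by
  refine ⟨hasDerivAt_gauss, fun x => ?_, fun x => ?_⟩
  · exact (hasDerivAt_poly_mul_gauss (P' := fun _ => -2)
      (((hasDerivAt_id x).const_mul (-2)).congr_deriv (by simp))).congr_deriv (by simp; ring)
  · exact (hasDerivAt_poly_mul_gauss (P' := fun x => 8 * x)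
      ((((hasDerivAt_id x).pow 2).const_mul 4).sub_const 2 |>.congr_deriv (by simp; ring))).congr_deriv
      (by simp; ring)

theorem derivChain_mul_gauss : DerivChain (fun x => x * Real.exp (-x ^ 2))
    (fun x => (1 - 2 * x ^ 2) * Real.exp (-x ^ 2))
    (fun x => (4 * x ^ 3 - 6 * x) * Real.exp (-x ^ 2))
    (fun x => (-8 * x ^ 4 + 24 * x ^ 2 - 6) * Real.exp (-x ^ 2)) := by
  refine ⟨fun x => ?_, fun x => ?_, fun x => ?_⟩
  · exact (hasDerivAt_poly_mul_gauss (P' := fun _ => 1) (hasDerivAt_id x)).congr_deriv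
      (by simp; ring)
  · exact (hasDerivAt_poly_mul_gauss (P' := fun x => -4 * x)
      ((((hasDerivAt_id x).pow 2).const_mul 2).const_sub 1 |>.congr_deriv (by simp; ring))).congr_deriv
      (by simp; ring)
  · exact (hasDerivAt_poly_mul_gauss (P' := fun x => 12 * x ^ 2 - 6)
      ((((hasDerivAt_id x).pow 3).const_mul 4).sub ((hasDerivAt_id x).const_mul 6)
        |>.congr_deriv (by simp; ring))).congr_deriv (by simp; ring)

theorem poly_decay {P : ℝ → ℝ} {a : ℝ} (hP : ∀ x, 0 ≤ x → |P x| ≤ a * (1 + x ^ 4)) (ha : 0 ≤ a) :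
    ∀ x, 0 ≤ x → |P x * Real.exp (-x ^ 2)| ≤ a * 75 * Real.exp (-x) := by
  intro x hx
  have h0 := pow_mul_exp_neg_sq_le hx 0
  have h4 := pow_mul_exp_neg_sq_le hx 4
  rw [abs_mul, Real.abs_exp]
  calc |P x| * Real.exp (-x ^ 2) ≤ a * (1 + x ^ 4) * Real.exp (-x ^ 2) :=
        mul_le_mul_of_nonneg_right (hP x hx) (Real.exp_nonneg _)
    _ = a * (x ^ 0 * Real.exp (-x ^ 2) + x ^ 4 * Real.exp (-x ^ 2)) := by ring
    _ ≤ a * (75 * Real.exp (-x)) := by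
        refine mul_le_mul_of_nonneg_left ?_ ha
        simp [Nat.factorial] at h0 h4
        linarith
    _ = _ := by ring

theorem decays_gauss : ∃ A, Decays A (fun x => Real.exp (-x ^ 2))
    (fun x => -2 * x * Real.exp (-x ^ 2)) (fun x => (4 * x ^ 2 - 2) * Real.exp (-x ^ 2))
    (fun x => (-8 * x ^ 3 + 12 * x) * Real.exp (-x ^ 2)) := by
  refine ⟨40 * 75, ⟨fun x hx => ?_, poly_decay (fun x hx => ?_) (by norm_num),
    poly_decay (fun x hx => ?_) (by norm_num), poly_decay (fun x hx => ?_) (by norm_num)⟩⟩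
  · simpa using poly_decay (P := fun _ => 1) (a := 40)
      (fun x hx => by rw [abs_one]; nlinarith [sq_nonneg (x ^ 2)]) (by norm_num) x hx
  all_goals
    rw [abs_le]
    constructor <;>
      nlinarith [sq_nonneg (x ^ 2 - 1), sq_nonneg (x - 1), sq_nonneg (x ^ 2 - x), sq_nonneg (x ^ 2),
        sq_nonneg (x ^ 2 + x), sq_nonneg (x + 1)]

theorem decays_mul_gauss : ∃ A, Decays A (fun x => x * Real.exp (-x ^ 2))
    (fun x => (1 - 2 * x ^ 2) * Real.exp (-x ^ 2))
    (fun x => (4 * x ^ 3 - 6 * x) * Real.exp (-x ^ 2))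
    (fun x => (-8 * x ^ 4 + 24 * x ^ 2 - 6) * Real.exp (-x ^ 2)) := by
  refine ⟨40 * 75, ⟨poly_decay (fun x hx => ?_) (by norm_num),
    poly_decay (fun x hx => ?_) (by norm_num),
    poly_decay (fun x hx => ?_) (by norm_num), poly_decay (fun x hx => ?_) (by norm_num)⟩⟩
  all_goals
    rw [abs_le]
    constructor <;>
      nlinarith [sq_nonneg (x ^ 2 - 1), sq_nonneg (x - 1), sq_nonneg (x ^ 2 - x), sq_nonneg (x ^ 2),
        sq_nonneg (x ^ 2 + x), sq_nonneg (x + 1)]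

/-! ### Sums over a cone of functions with a dihedral symmetry -/

theorem sum_reflect {q : ℕ} {p : ℤ → ℝ} (hp : Function.Periodic p q) (b : ℝ → ℝ) :
    ∑ i ∈ range q, p (-i) * b i = ∑ i ∈ range q, p i * b (q - i) + p 0 * (b 0 - b q) := by
  have h := sum_range_reflect (fun i : ℕ => p (-(i + 1 : ℕ)) * b (i + 1 : ℕ)) q
  have h2 := sum_range_succ' (fun i : ℕ => p (-i) * b i) q
  rw [sum_range_succ] at h2
  have h3 : p (-(q : ℤ)) = p 0 := by simpa using (hp (-(q : ℤ))).symm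
  have h4 : ∑ i ∈ range q, p i * b (q - i) =
      ∑ j ∈ range q, p (-((q - 1 - j + 1 : ℕ) : ℤ)) * b ((q - 1 - j + 1 : ℕ) : ℝ) := by
    refine sum_congr rfl fun j hj => ?_
    have : q - 1 - j + 1 = q - j := by have := mem_range.1 hj; omega
    rw [this, Nat.cast_sub (mem_range.1 hj).le, Nat.cast_sub (mem_range.1 hj).le]
    congr 1
    have := hp (-((q : ℤ) - j))
    rw [← this]
    congr 1
    ring
  rw [h4, h]
  simp only [Nat.cast_zero, neg_zero, h3] at h2
  linarith

/-- The symmetries of `(x, y) ↦ f (x² + n x y - y²)` for odd `q`-periodic `f`. -/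
structure Weight (n q : ℕ) (w : ℤ → ℤ → ℝ) : Prop where
  pos : 0 < q
  perX : ∀ X Y, w (X + q) Y = w X Y
  perY : ∀ X Y, w X (Y + q) = w X Y
  neg : ∀ X Y, w (-X) (-Y) = w X Y
  rot : ∀ X Y, w Y (-X) = -w X Y
  refl : ∀ X Y, w X (n * X - Y) = w X Y

namespace Weight
variable {n q : ℕ} {w : ℤ → ℤ → ℝ}

theorem edge_neg (hw : Weight n q w) (X : ℤ) : edge q (w (-X)) 0 = - edge q (w X) 0 := by
  have hq := hw.pos
  have hq' : (q : ℝ) ≠ 0 := by positivity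
  have h1 : ∀ i : ℤ, w (-X) i = w X (-i) := fun i => by rw [← hw.neg X (-i), neg_neg]
  have h := sum_reflect (p := w X) (hw.perY X) (β₁ q)
  have h2 : ∀ x, β₁ q (q - x) = - β₁ q x := fun x => by simp only [β₁]; field_simp; ring
  have h3 : β₁ q 0 - β₁ q q = -1 := by simp only [β₁]; field_simp; ring
  simp only [edge, shiftSum, zero_add, h1, neg_zero, h, h2, h3, mul_neg, sum_neg_distrib]
  ring

theorem edge_refl (hw : Weight n q w) (X : ℤ) :
    edge q (w X) (n * X) = - edge q (w X) 0 := by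
  rw [← hw.edge_neg]
  have h1 : ∀ i : ℤ, w X (n * X + i) = w (-X) i := fun i => by
    rw [← hw.neg (-X) i, neg_neg, ← hw.refl X (-i)]; congr 1; ring
  have h2 := h1 0
  rw [add_zero] at h2
  simp only [edge, shiftSum, h1, h2, zero_add]

theorem shiftSum_refl (hw : Weight n q w) (X : ℤ) :
    shiftSum q (β₂ q) (w X) (n * X) = shiftSum q (β₂ q) (w X) 0 := by
  have hq := hw.pos
  have hq' : (q : ℝ) ≠ 0 := by positivity
  have h1 : ∀ i : ℤ, w X (n * X + i) = w X (-i) := fun i => by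
    rw [← hw.refl X (-i)]; congr 1; ring
  have h := sum_reflect (p := w X) (hw.perY X) (β₂ q)
  have h2 : ∀ x, β₂ q (q - x) = β₂ q x := fun x => by simp only [β₂]; field_simp; ring
  have h3 : β₂ q 0 - β₂ q q = 0 := by simp only [β₂]; field_simp; ring
  simp only [shiftSum, zero_add, h1, h, h2, h3, mul_zero, add_zero]

theorem sum_rot (hw : Weight n q w) (b : ℝ → ℝ) :
    ∑ X ∈ range q, ∑ Y ∈ range q, w X Y * b Y = -∑ X ∈ range q, ∑ Y ∈ range q, w X Y * b X := by
  rw [sum_comm, ← sum_neg_distrib]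
  refine sum_congr rfl fun Y _ => ?_
  have h := sum_reflect (p := w Y) (hw.perY Y) (fun _ => 1)
  simp only [mul_one, sub_self, mul_zero, add_zero, hw.rot, sum_neg_distrib] at h
  rw [← sum_mul, ← sum_mul, ← h]
  ring

theorem sum_eq_zero (hw : Weight n q w) : ∑ X ∈ range q, ∑ Y ∈ range q, w X Y = 0 := by
  have := hw.sum_rot (fun _ => 1)
  simp only [mul_one] at this
  linarith

theorem sum_edge (hw : Weight n q w) : ∑ X ∈ range q, edge q (w X) 0 = 0 := by
  have hp : Function.Periodic (fun X => edge q (w X) 0) q := fun X => by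
    simp only [edge, shiftSum, hw.perX]
  have h := sum_reflect hp (fun _ => 1)
  simp only [mul_one, sub_self, mul_zero, add_zero, hw.edge_neg, sum_neg_distrib] at h
  linarith

theorem edge_zero (hw : Weight n q w) : edge q (w 0) 0 = 0 := by
  have := hw.edge_neg 0
  rw [neg_zero] at this
  linarith

theorem bounded (hw : Weight n q w) : ∃ B, 0 ≤ B ∧ ∀ X i, |w X i| ≤ B := by
  have hq := hw.pos
  have h1 : ∀ i : ℤ, ∃ B, 0 ≤ B ∧ ∀ X, |w X i| ≤ B := fun i =>
    exists_periodic_bound (p := fun X => w X i) hq (fun X => hw.perX X i)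
  choose b hb0 hb using h1
  obtain ⟨B, hB0, hB⟩ := exists_periodic_bound (p := fun Y => ∑ j ∈ range q, b j) hq (fun X => rfl)
  refine ⟨B, hB0, fun X i => ?_⟩
  have h0 := Int.emod_nonneg i (b := q) (by positivity)
  have h1 := Int.emod_lt_of_pos i (b := q) (by positivity)
  have h2 : w X i = w X ((i % q).toNat : ℕ) := by
    have h3 : i = i % q + (i / q) * q := by have := Int.emod_add_mul_ediv i q; linarith
    have h4 := ((show Function.Periodic (w X) q from hw.perY X).int_mul (i / q)) (i % q)
    rw [Int.toNat_of_nonneg h0, ← h4]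
    congr 1
  rw [h2]
  refine (hb _ X).trans (le_trans ?_ ((le_abs_self _).trans (hB 0)))
  exact single_le_sum (f := fun j : ℕ => b j) (fun j _ => hb0 j) (mem_range.2 (by omega))

end Weight

/-- The integral of the Gaussian weight over a vertical slice of the cone. -/
noncomputable def coneIntegral (n : ℕ) (z : ℝ) : ℝ :=
  ∫ v in (0 : ℝ)..n, Real.exp (-z ^ 2 * (1 + n * v - v ^ 2))

/-- The part of the weighted cone sum with first coordinate `X`. -/
noncomputable def coneSlice (n : ℕ) (w : ℤ → ℤ → ℝ) (u : ℝ) (X : ℕ) : ℝ :=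
  ∑ Y ∈ range (n * X), w X Y * Real.exp (-u ^ 2 * ((X : ℝ) ^ 2 + n * X * Y - (Y : ℝ) ^ 2))

theorem coneSlice_estimate {n q : ℕ} {w : ℤ → ℤ → ℝ} (hw : Weight n q w) : ∃ C, 0 ≤ C ∧
    ∀ u, 0 < u → ∀ X : ℕ, |coneSlice n w u X -
      (mean q (w X) * X * coneIntegral n (u * X) - 2 * edge q (w X) 0 * Real.exp (-(u * X) ^ 2)
        + 2 * n * u * shiftSum q (β₂ q) (w X) 0 * (u * X * Real.exp (-(u * X) ^ 2)))|
      ≤ C * u ^ 2 * Real.exp (-(u * X)) := by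
  have hq := hw.pos
  obtain ⟨B, hB0, hB⟩ := hw.bounded
  obtain ⟨C, hC0, hC⟩ := euler_maclaurin hq hB0
  refine ⟨C * (6 * n ^ 2 * 6 + n ^ 4 * 72) + 2 * C * (2 * 3 + n ^ 2 * 6), by positivity,
    fun u hu X => ?_⟩
  obtain ⟨hb, hem⟩ := hC (w X) (hw.perY X) (hB X)
  set F : ℝ → ℝ := fun y => Real.exp (-u ^ 2 * ((X : ℝ) ^ 2 + n * X * y - y ^ 2)) with hF
  set l : ℝ → ℝ := fun y => -u ^ 2 * (n * X - 2 * y) with hl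
  have dF : ∀ y, HasDerivAt F (l y * F y) y := fun y =>
    (((((hasDerivAt_id y).const_mul (n * X : ℝ)).const_add ((X : ℝ) ^ 2)).sub
      ((hasDerivAt_id y).pow 2)).const_mul (-u ^ 2)).exp.congr_deriv (by simp [F, l]; ring)
  have dl : ∀ y, HasDerivAt l (2 * u ^ 2) y := fun y =>
    ((((hasDerivAt_id y).const_mul 2).const_sub (n * X : ℝ)).const_mul (-u ^ 2)).congr_deriv
      (by simp; ring)
  have chain : DerivChain F (fun y => l y * F y) (fun y => (2 * u ^ 2 + l y ^ 2) * F y)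
      (fun y => (6 * u ^ 2 * l y + l y ^ 3) * F y) :=
    ⟨dF, fun y => ((dl y).mul (dF y)).congr_deriv (by ring),
      fun y => ((((dl y).pow 2).const_add (2 * u ^ 2)).mul (dF y)).congr_deriv (by simp; ring)⟩
  have cF : Continuous F := continuous_iff_continuousAt.2 fun y => (dF y).continuousAt
  set Φ : ℝ → ℝ := fun y => mean q (w X) * ∫ t in (0 : ℝ)..y, F t
  have dΦ : ∀ y, HasDerivAt Φ (mean q (w X) * F y) y := fun y =>
    ((cF.integral_hasStrictDerivAt 0 y).hasDerivAt).const_mul _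
  set z := u * X with hz
  have hz0 : 0 ≤ z := by positivity
  have hFle : ∀ y : ℝ, 0 ≤ y → y ≤ n * X → F y ≤ Real.exp (-z ^ 2) := fun y h0 h1 => by
    refine Real.exp_le_exp.2 ?_
    have h2 : 0 ≤ u ^ 2 * (y * (n * X - y)) :=
      mul_nonneg (sq_nonneg u) (mul_nonneg h0 (by linarith))
    rw [hz]
    linarith
  have hl1 : ∀ y : ℝ, 0 ≤ y → y ≤ n * X → |l y| ≤ u * (n * z) := fun y h0 h1 => by
    simp only [l, abs_mul, abs_neg, abs_of_pos (pow_pos hu 2)]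
    have : |(n * X : ℝ) - 2 * y| ≤ n * X := abs_le.2 ⟨by linarith, by linarith⟩
    calc u ^ 2 * |(n * X : ℝ) - 2 * y| ≤ u ^ 2 * (n * X) :=
          mul_le_mul_of_nonneg_left this (by positivity)
      _ = _ := by rw [hz]; ring
  have g2 := pow_mul_exp_neg_sq_le hz0 2
  have g4 := pow_mul_exp_neg_sq_le hz0 4
  have g0 := pow_mul_exp_neg_sq_le hz0 0
  simp only [Nat.factorial] at g0 g2 g4
  norm_num at g0 g2 g4
  have hF3 : ∀ y : ℝ, 0 ≤ y → y ≤ n * X → |(6 * u ^ 2 * l y + l y ^ 3) * F y| ≤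
      (6 * u ^ 3 * n * z + u ^ 3 * n ^ 3 * z ^ 3) * Real.exp (-z ^ 2) := fun y h0 h1 => by
    rw [abs_mul, abs_of_pos (Real.exp_pos _ : 0 < F y)]
    refine mul_le_mul ?_ (hFle y h0 h1) (Real.exp_nonneg _) (by positivity)
    refine (abs_add_le _ _).trans ?_
    rw [abs_mul, abs_pow, abs_of_pos (by positivity : 0 < 6 * u ^ 2)]
    have h2 := hl1 y h0 h1
    have h3 : |l y| ^ 3 ≤ (u * (n * z)) ^ 3 := by gcongr
    have h4 : 6 * u ^ 2 * |l y| ≤ 6 * u ^ 2 * (u * (n * z)) := by gcongr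
    calc _ ≤ _ := add_le_add h4 h3
      _ = _ := by ring
  have main := hem F _ _ _ Φ chain dΦ (n * X)
    (fun _ => (6 * u ^ 3 * n * z + u ^ 3 * n ^ 3 * z ^ 3) * Real.exp (-z ^ 2))
    (fun j hj x hx => hF3 x ((Nat.cast_nonneg j).trans hx.1) (hx.2.trans (by exact_mod_cast hj)))
  have hend : F (n * X) = Real.exp (-z ^ 2) := by simp only [F, hz]; congr 1; ring
  have hend0 : F 0 = Real.exp (-z ^ 2) := by simp only [F, hz]; congr 1; ring
  have htrap : ∑ j ∈ range (n * X), (w X j * F j + w X (j + 1) * F (j + 1)) / 2 =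
      coneSlice n w u X := by
    have h1 : ∀ M : ℕ, ∑ j ∈ range M, (w X j * F j + w X (j + 1) * F (j + 1)) / 2 =
      ∑ j ∈ range M, w X j * F j - w X 0 * F 0 / 2 + w X M * F M / 2 := by
      intro M
      induction M with
      | zero => simp
      | succ M ih => rw [sum_range_succ, ih, sum_range_succ]; push_cast; ring
    rw [h1]
    have h2 := hw.refl X 0
    rw [sub_zero] at h2
    push_cast
    rw [h2, hend, hend0, coneSlice]
    ring
  have hint : Φ (n * X) - Φ 0 = mean q (w X) * X * coneIntegral n z := by
    simp only [Φ, intervalIntegral.integral_same, mul_zero, sub_zero, coneIntegral, mul_assoc]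
    have := intervalIntegral.mul_integral_comp_mul_left (f := F) (a := 0) (b := n) (X : ℝ)
    rw [mul_zero, mul_comm (X : ℝ) n] at this
    rw [← this]
    congr 3
    ext v
    simp only [F, hz]
    congr 1
    ring
  have hl0 : l 0 = -(u * (n * z)) := by simp only [l, hz]; ring
  have hlM : l (n * X) = u * (n * z) := by simp only [l, hz]; ring
  push_cast at main
  rw [htrap, hint, hw.edge_refl, hw.shiftSum_refl, hend, hend0, hl0, hlM, sum_const,
    card_range, nsmul_eq_mul] at main
  have eK : C * ((n * X : ℕ) * ((6 * u ^ 3 * n * z + u ^ 3 * n ^ 3 * z ^ 3) * Real.exp (-z ^ 2))) ≤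
      C * (6 * n ^ 2 * 6 + n ^ 4 * 72) * u ^ 2 * Real.exp (-z) := by
    refine (mul_le_mul_of_nonneg_left (c := u ^ 2 * (6 * n ^ 2 * (6 * Real.exp (-z)) +
      n ^ 4 * (72 * Real.exp (-z)))) ?_ hC0).trans_eq (by ring)
    calc ((n * X : ℕ) * ((6 * u ^ 3 * n * z + u ^ 3 * n ^ 3 * z ^ 3) * Real.exp (-z ^ 2)))
        = u ^ 2 * (6 * n ^ 2 * (z ^ 2 * Real.exp (-z ^ 2))
            + n ^ 4 * (z ^ 4 * Real.exp (-z ^ 2))) := by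
          rw [hz]; push_cast; ring
      _ ≤ u ^ 2 * (6 * n ^ 2 * (6 * Real.exp (-z)) + n ^ 4 * (72 * Real.exp (-z))) := by gcongr
  have e2 : ∀ s M, |s| = u * (n * z) → |shiftSum q (β₃ q) (w X) M
      * ((2 * u ^ 2 + s ^ 2) * Real.exp (-z ^ 2))|
      ≤ C * (2 * 3 + n ^ 2 * 6) * u ^ 2 * Real.exp (-z) := fun s M hs => by
    rw [abs_mul]
    refine (mul_le_mul (d := u ^ 2 * (2 * (3 * Real.exp (-z)) + n ^ 2 * (6 * Real.exp (-z))))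
      (hb M).2.2 ?_ (abs_nonneg _) hC0).trans_eq (by ring)
    rw [← sq_abs s, hs, abs_of_nonneg (by positivity)]
    calc (2 * u ^ 2 + (u * (n * z)) ^ 2) * Real.exp (-z ^ 2)
        = u ^ 2 * (2 * Real.exp (-z ^ 2) + n ^ 2 * (z ^ 2 * Real.exp (-z ^ 2))) := by ring
      _ ≤ u ^ 2 * (2 * (3 * Real.exp (-z)) + n ^ 2 * (6 * Real.exp (-z))) := by gcongr
  have k1 := e2 (-(u * (n * z))) 0 (by rw [abs_neg, abs_of_nonneg (by positivity)])
  have k2 := e2 (u * (n * z)) (n * X) (by rw [abs_of_nonneg (by positivity)])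
  rw [abs_le] at *
  constructor <;> linarith [main.1, main.2, k1.1, k1.2, k2.1, k2.2]

/-! ### The limit of the cone sums -/

theorem tendsto_gauss_atTop : Tendsto (fun x : ℝ => Real.exp (-x ^ 2)) atTop (𝓝 0) :=
  Real.tendsto_exp_neg_atTop_nhds_zero.comp (tendsto_pow_atTop two_ne_zero)

theorem tsum_exp_neg_le {u : ℝ} (hu : 0 < u) (hu1 : u ≤ 1) :
    ∑' j : ℕ, Real.exp (-(u * j)) ≤ 2 / u :=
  (summable_exp_neg_mul hu).tsum_le_of_sum_range_le (geom_bound hu hu1)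

section Periodic
variable {q : ℕ} {p : ℤ → ℝ}

theorem tsum_gauss (hq : 0 < q) (hp : Function.Periodic p q) (h0 : p 0 = 0) (hm : mean q p = 0) :
    (∀ u : ℝ, 0 < u → u ≤ 1 → Summable (fun j : ℕ => p j * Real.exp (-(u * j) ^ 2))) ∧
    Tendsto (fun u : ℝ => ∑' j : ℕ, p j * Real.exp (-(u * j) ^ 2)) (𝓝[>] 0)
      (𝓝 (-edge q p 0)) := by
  obtain ⟨A, hA⟩ := decays_gauss
  obtain ⟨C, hC⟩ := euler_maclaurin_tsum hq hp derivChain_gauss hA (Φ := fun _ => 0)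
    (fun x => (hasDerivAt_const x (0 : ℝ)).congr_deriv (by rw [hm, zero_mul])) tendsto_const_nhds
  refine ⟨fun u hu hu1 => (hC u hu hu1).1, ?_⟩
  rw [tendsto_iff_norm_sub_tendsto_zero]
  have hlim : Tendsto (fun u : ℝ => C * u ^ 2) (𝓝[>] 0) (𝓝 0) := by
    have : Tendsto (fun u : ℝ => C * u ^ 2) (𝓝 0) (𝓝 (C * 0 ^ 2)) :=
      (continuous_const.mul (continuous_pow 2)).tendsto 0
    simpa using this.mono_left nhdsWithin_le_nhds
  refine squeeze_zero' (Eventually.of_forall fun _ => norm_nonneg _) ?_ hlim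
  filter_upwards [Ioc_mem_nhdsGT (show (0 : ℝ) < 1 by norm_num)] with u hu
  have := (hC u hu.1 hu.2).2
  simpa [h0] using this

theorem tsum_mul_gauss (hq : 0 < q) (hp : Function.Periodic p q) :
    ∃ C, ∀ u : ℝ, 0 < u → u ≤ 1 → Summable (fun j : ℕ => p j * (u * j * Real.exp (-(u * j) ^ 2))) ∧
      |∑' j : ℕ, p j * (u * j * Real.exp (-(u * j) ^ 2)) - mean q p / 2 / u
        + u * shiftSum q (β₂ q) p 0| ≤ C * u ^ 2 := by
  obtain ⟨A, hA⟩ := decays_mul_gauss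
  obtain ⟨C, hC⟩ := euler_maclaurin_tsum hq hp derivChain_mul_gauss hA
    (Φ := fun x => -(mean q p / 2) * Real.exp (-x ^ 2))
    (fun x => ((hasDerivAt_gauss x).const_mul _).congr_deriv (by ring))
    (by simpa using tendsto_gauss_atTop.const_mul (-(mean q p / 2)))
  refine ⟨C, fun u hu hu1 => ⟨(hC u hu hu1).1, ?_⟩⟩
  have := (hC u hu hu1).2
  simpa using this

end Periodic

namespace Weight
variable {n q : ℕ} {w : ℤ → ℤ → ℝ}

theorem mean_periodic (hw : Weight n q w) : Function.Periodic (fun X => mean q (w X)) q := fun X => by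
  simp only [mean, hw.perX]

theorem mean_mean (hw : Weight n q w) : mean q (fun X => mean q (w X)) = 0 := by
  simp only [mean, ← sum_div, hw.sum_eq_zero, zero_div]

theorem tendsto_mean (hw : Weight n q w) :
    (∀ᶠ u : ℝ in 𝓝[>] 0, Summable fun X : ℕ => mean q (w X) * X * coneIntegral n (u * X)) ∧
    Tendsto (fun u : ℝ => ∑' X : ℕ, mean q (w X) * X * coneIntegral n (u * X)) (𝓝[>] 0)
      (𝓝 (-(n * shiftSum q (β₂ q) (fun X => mean q (w X)) 0))) := by
  set p : ℤ → ℝ := fun X => mean q (w X) with hp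
  set b := shiftSum q (β₂ q) p 0
  obtain ⟨B, hB0, hB⟩ := exists_periodic_bound hw.pos hw.mean_periodic
  obtain ⟨C, hC⟩ := tsum_mul_gauss hw.pos hw.mean_periodic
  rw [hw.mean_mean] at hC
  have key : ∀ u : ℝ, 0 < u → u * (1 + n) ≤ 1 →
      (Summable fun X : ℕ => p X * X * coneIntegral n (u * X)) ∧
      |∑' X : ℕ, p X * X * coneIntegral n (u * X) + n * b| ≤ |C| * (u * (1 + n)) * n := by
    intro u hu hun
    set g : ℕ → ℝ → ℝ := fun X v => p X * X * Real.exp (-(u * X) ^ 2 * (1 + n * v - v ^ 2))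
    have hρ : ∀ v ∈ Set.Icc (0 : ℝ) n, 1 ≤ 1 + n * v - v ^ 2 ∧ 1 + n * v - v ^ 2 ≤ (1 + n) ^ 2 :=
      fun v hv => ⟨by nlinarith [hv.1, hv.2, mul_nonneg hv.1 (sub_nonneg.2 hv.2)],
        by nlinarith [hv.1, hv.2, mul_nonneg hv.1 (sub_nonneg.2 hv.2),
          mul_nonneg (Nat.cast_nonneg n : (0:ℝ) ≤ n) (sub_nonneg.2 hv.2)]⟩
    have hgc : ∀ X, Continuous (g X) := fun X => by fun_prop
    have hgb : ∀ X, ∀ v ∈ Set.Icc (0 : ℝ) n, ‖g X v‖ ≤ B * 3 / u * Real.exp (-(u * X)) := by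
      intro X v hv
      have h1 := pow_mul_exp_neg_sq_le (x := u * X) (by positivity) 1
      rw [Real.norm_eq_abs, abs_mul, abs_mul, Nat.abs_cast, Real.abs_exp]
      have h2 : Real.exp (-(u * X) ^ 2 * (1 + n * v - v ^ 2)) ≤ Real.exp (-(u * X) ^ 2) :=
        Real.exp_le_exp.2 (by nlinarith [(hρ v hv).1, sq_nonneg (u * X)])
      calc |p X| * X * Real.exp (-(u * X) ^ 2 * (1 + n * v - v ^ 2))
          ≤ B * X * Real.exp (-(u * X) ^ 2) := by
            have := hB X
            gcongr
        _ = B / u * ((u * X) ^ 1 * Real.exp (-(u * X) ^ 2)) := by field_simp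
        _ ≤ B / u * ((1 : ℕ).factorial * 3 * Real.exp (-(u * X))) := by gcongr
        _ = _ := by simp; ring
    have hsb : Summable fun X : ℕ => B * 3 / u * Real.exp (-(u * X)) :=
      (summable_exp_neg_mul hu).mul_left _
    have hgs : ∀ v ∈ Set.Icc (0 : ℝ) n, Summable fun X => g X v := fun v hv =>
      Summable.of_norm_bounded hsb fun X => hgb X v hv
    have hIoc : Set.uIoc (0 : ℝ) n = Set.Ioc (0 : ℝ) n := Set.uIoc_of_le (Nat.cast_nonneg n)
    have hIcc : Set.uIcc (0 : ℝ) n = Set.Icc (0 : ℝ) n := Set.uIcc_of_le (Nat.cast_nonneg n)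
    have hint := intervalIntegral.hasSum_integral_of_dominated_convergence
      (μ := MeasureTheory.volume) (a := (0 : ℝ)) (b := n) (F := g) (f := fun v => ∑' X, g X v)
      (fun X _ => B * 3 / u * Real.exp (-(u * X)))
      (fun X => (hgc X).aestronglyMeasurable)
      (fun X => Eventually.of_forall fun v hv => by
        rw [hIoc] at hv
        exact hgb X v (Set.Ioc_subset_Icc_self hv))
      (Eventually.of_forall fun _ _ => hsb)
      (by simp)
      (Eventually.of_forall fun v hv => by
        rw [hIoc] at hv
        exact (hgs v (Set.Ioc_subset_Icc_self hv)).hasSum)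
    have hgi : ∀ X : ℕ, ∫ v in (0 : ℝ)..n, g X v = p X * X * coneIntegral n (u * X) := fun X => by
      simp only [g, coneIntegral, intervalIntegral.integral_const_mul]
    simp only [hgi] at hint
    refine ⟨hint.summable, ?_⟩
    have hcont : ContinuousOn (fun v => ∑' X, g X v) (Set.Icc (0 : ℝ) n) :=
      continuousOn_tsum (fun X => (hgc X).continuousOn) hsb hgb
    have hii : IntervalIntegrable (fun v => ∑' X, g X v) MeasureTheory.volume 0 n := by
      apply ContinuousOn.intervalIntegrable
      rwa [hIcc]
    have hadd : ∑' X : ℕ, p X * X * coneIntegral n (u * X) + n * b =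
        ∫ v in (0 : ℝ)..n, ((∑' X, g X v) + b) := by
      rw [intervalIntegral.integral_add hii intervalIntegrable_const, hint.tsum_eq]
      simp
    rw [hadd]
    have := intervalIntegral.norm_integral_le_of_norm_le_const (a := (0 : ℝ)) (b := n)
      (f := fun v => (∑' X, g X v) + b) (C := |C| * (u * (1 + n))) (fun v hv => by
        rw [hIoc] at hv
        obtain ⟨h1, h2⟩ := hρ v (Set.Ioc_subset_Icc_self hv)
        set ρ := 1 + n * v - v ^ 2 with hρd
        have hs0 : 0 < u * √ρ := mul_pos hu (Real.sqrt_pos.2 (by linarith))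
        have hs1 : u * √ρ ≤ u * (1 + n) :=
          mul_le_mul_of_nonneg_left (Real.sqrt_le_iff.2 ⟨by positivity, h2⟩) hu.le
        obtain ⟨_, hC2⟩ := hC (u * √ρ) hs0 (hs1.trans hun)
        have e : ∑' j : ℕ, p j * (u * √ρ * j * Real.exp (-(u * √ρ * j) ^ 2)) =
            u * √ρ * ∑' X, g X v := by
          rw [← tsum_mul_left]
          refine tsum_congr fun j => ?_
          have : -(u * √ρ * j) ^ 2 = -(u * j) ^ 2 * (1 + n * v - v ^ 2) := by
            rw [mul_pow, mul_pow, Real.sq_sqrt (by linarith)]; ring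
          simp only [g, this]
          ring
        rw [e] at hC2
        simp only [zero_div, sub_zero] at hC2
        have hC3 : u * √ρ * |∑' X, g X v + b| ≤ u * √ρ * (C * (u * √ρ)) := by
          rw [← abs_of_pos hs0, ← abs_mul, mul_add, abs_of_pos hs0]
          exact hC2.trans_eq (by ring)
        rw [Real.norm_eq_abs]
        calc _ ≤ C * (u * √ρ) := le_of_mul_le_mul_left hC3 hs0
          _ ≤ |C| * (u * (1 + n)) := by
            refine mul_le_mul (le_abs_self C) hs1 hs0.le (abs_nonneg _))
    simpa using this
  have hev : ∀ᶠ u : ℝ in 𝓝[>] 0, 0 < u ∧ u * (1 + n) ≤ 1 := by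
    filter_upwards [Ioc_mem_nhdsGT (show (0 : ℝ) < 1 / (1 + n) by positivity)] with u hu
    exact ⟨hu.1, (le_div_iff₀ (by positivity)).1 hu.2⟩
  refine ⟨hev.mono fun u hu => (key u hu.1 hu.2).1, ?_⟩
  rw [tendsto_iff_norm_sub_tendsto_zero]
  have hlim : Tendsto (fun u : ℝ => |C| * (u * (1 + n)) * n) (𝓝[>] 0) (𝓝 0) := by
    have : Tendsto (fun u : ℝ => |C| * (u * (1 + n)) * n) (𝓝 0) (𝓝 (|C| * (0 * (1 + n)) * n)) :=
      Continuous.tendsto (by fun_prop) 0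
    simpa using this.mono_left nhdsWithin_le_nhds
  refine squeeze_zero' (Eventually.of_forall fun _ => norm_nonneg _) ?_ hlim
  filter_upwards [hev] with u hu
  simpa using (key u hu.1 hu.2).2

/-- The limit of the smoothed sum of `w` over the fundamental cone. -/
theorem tendsto_cone (hw : Weight n q w) :
    Tendsto (fun u : ℝ => ∑' X : ℕ, coneSlice n w u X) (𝓝[>] 0)
      (𝓝 (2 * edge q (fun X => edge q (w X) 0) 0
        + n * mean q (fun X => shiftSum q (β₂ q) (w X) 0)
        - n * shiftSum q (β₂ q) (fun X => mean q (w X)) 0)) := by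
  obtain ⟨C, hC0, hC⟩ := coneSlice_estimate hw
  obtain ⟨sA, tA⟩ := hw.tendsto_mean
  have pe : Function.Periodic (fun X => edge q (w X) 0) q := fun X => by
    simp only [edge, shiftSum, hw.perX]
  have pc : Function.Periodic (fun X => shiftSum q (β₂ q) (w X) 0) q := fun X => by
    simp only [shiftSum, hw.perX]
  obtain ⟨sB, tB⟩ := tsum_gauss hw.pos pe hw.edge_zero
    (by simp only [mean, hw.sum_edge, zero_div])
  obtain ⟨K, hK⟩ := tsum_mul_gauss hw.pos pc
  set mc := mean q (fun X => shiftSum q (β₂ q) (w X) 0)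
  set c : ℝ := shiftSum q (β₂ q) (fun X => shiftSum q (β₂ q) (w X) 0) 0
  have lim0 : ∀ f : ℝ → ℝ, Continuous f → Tendsto f (𝓝[>] 0) (𝓝 (f 0)) := fun f hf =>
    (hf.tendsto 0).mono_left nhdsWithin_le_nhds
  have hev : ∀ᶠ u : ℝ in 𝓝[>] 0, 0 < u ∧ u ≤ 1 := by
    filter_upwards [Ioc_mem_nhdsGT (show (0 : ℝ) < 1 by norm_num)] with u hu using hu
  have tC : Tendsto (fun u : ℝ => u * ∑' X : ℕ, shiftSum q (β₂ q) (w X) 0 *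
      (u * X * Real.exp (-(u * X) ^ 2))) (𝓝[>] 0) (𝓝 (mc / 2)) := by
    rw [tendsto_iff_norm_sub_tendsto_zero]
    have hl := lim0 (fun u => u * (K * u ^ 2) + u * (u * |c|)) (by fun_prop)
    simp only [zero_mul, add_zero] at hl
    refine squeeze_zero' (Eventually.of_forall fun _ => norm_nonneg _) ?_ hl
    filter_upwards [hev] with u hu
    have h := (hK u hu.1 hu.2).2
    set T := ∑' X : ℕ, shiftSum q (β₂ q) (w X) 0 * (u * X * Real.exp (-(u * X) ^ 2))
    have e : u * T - mc / 2 = u * (T - mc / 2 / u + u * c) - u * (u * c) := by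
      have := hu.1.ne'
      field_simp
      ring
    rw [Real.norm_eq_abs, e]
    refine (abs_sub _ _).trans (add_le_add ?_ ?_)
    · rw [abs_mul, abs_of_pos hu.1]
      exact mul_le_mul_of_nonneg_left h hu.1.le
    · rw [abs_mul, abs_mul, abs_of_pos hu.1]
  have main := (tA.sub (tB.const_mul 2)).add (tC.const_mul (2 * n : ℝ))
  have err : Tendsto (fun u : ℝ => ∑' X : ℕ, coneSlice n w u X -
      (∑' X : ℕ, mean q (w X) * X * coneIntegral n (u * X)
      - 2 * ∑' X : ℕ, edge q (w X) 0 * Real.exp (-(u * X) ^ 2)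
      + 2 * n * (u * ∑' X : ℕ, shiftSum q (β₂ q) (w X) 0 * (u * X * Real.exp (-(u * X) ^ 2)))))
      (𝓝[>] 0) (𝓝 0) := by
    have hl := lim0 (fun u => C * u * 2) (by fun_prop)
    simp only [mul_zero, zero_mul] at hl
    refine squeeze_zero_norm' ?_ hl
    filter_upwards [hev, sA] with u hu hA
    have s2 := (sB u hu.1 hu.2).mul_left 2
    have s3 := ((hK u hu.1 hu.2).1.mul_left u).mul_left (2 * n : ℝ)
    have sE : Summable fun X : ℕ => C * u ^ 2 * Real.exp (-(u * X)) :=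
      (summable_exp_neg_mul hu.1).mul_left _
    have sD := Summable.of_norm_bounded sE fun X => (Real.norm_eq_abs _).trans_le (hC u hu.1 X)
    have sM := (hA.sub s2).add s3
    rw [← tsum_mul_left, ← tsum_mul_left, ← tsum_mul_left, ← hA.tsum_sub s2,
      ← (hA.sub s2).tsum_add s3]
    have sS : Summable (coneSlice n w u) := by
      refine (sD.add sM).congr fun X => ?_
      ring
    rw [← sS.tsum_sub sM]
    have hle := tsum_of_norm_bounded sE.hasSum (f := fun X : ℕ => coneSlice n w u X -
      (mean q (w X) * X * coneIntegral n (u * X) - 2 * edge q (w X) 0 * Real.exp (-(u * X) ^ 2)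
        + 2 * n * u * shiftSum q (β₂ q) (w X) 0 * (u * X * Real.exp (-(u * X) ^ 2))))
      fun X => (Real.norm_eq_abs _).trans_le (hC u hu.1 X)
    refine le_trans (le_of_eq ?_) (hle.trans ?_)
    · congr 1
      refine tsum_congr fun X => ?_
      ring
    · rw [tsum_mul_left]
      calc C * u ^ 2 * ∑' X : ℕ, Real.exp (-(u * X)) ≤ C * u ^ 2 * (2 / u) :=
            mul_le_mul_of_nonneg_left (tsum_exp_neg_le hu.1 hu.2) (by positivity)
        _ = C * u * 2 := by have := hu.1.ne'; field_simp
  have := err.add main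
  simp only [sub_add_cancel] at this
  convert this using 2
  ring

end Weight

/-! ### Sums over hyperbolas of periodic functions -/

/-- Rational functions of `exp (-x)`, a family stable under differentiation. -/
noncomputable def expRatio (P Q : Polynomial ℝ) (j : ℕ) (x : ℝ) : ℝ :=
  Real.exp (-x) * P.eval (Real.exp (-x)) / Q.eval (Real.exp (-x)) ^ j

theorem expRatio_hasDerivAt (P Q : Polynomial ℝ) (j : ℕ) (hQ : ∀ x, Q.eval (Real.exp (-x)) ≠ 0)
    (x : ℝ) : HasDerivAt (expRatio P Q j) (expRatio (-(P + .X * P.derivative) * Q +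
      j * .X * P * Q.derivative) Q (j + 1) x) x := by
  have he : HasDerivAt (fun x : ℝ => Real.exp (-x)) (-Real.exp (-x)) x :=
    ((hasDerivAt_id x).neg.exp).congr_deriv (by simp)
  have hP := (P.hasDerivAt (Real.exp (-x))).comp x he
  have hQ' := ((Q.hasDerivAt (Real.exp (-x))).comp x he).pow j
  refine ((he.mul hP).div hQ' (pow_ne_zero j (hQ x))).congr_deriv ?_
  have := hQ x
  simp only [expRatio, Function.comp, Pi.mul_apply, Pi.pow_apply]
  rcases j with _ | j
  · simp
    field_simp
    ring
  · simp
    field_simp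
    ring

theorem expRatio_bound (P Q : Polynomial ℝ) : ∃ A, ∀ j x, 0 ≤ x → 1 ≤ Q.eval (Real.exp (-x)) →
    |expRatio P Q j x| ≤ A * Real.exp (-x) := by
  refine ⟨∑ i ∈ P.support, |P.coeff i|, fun j x hx hQ => ?_⟩
  have hy0 : 0 ≤ Real.exp (-x) := Real.exp_nonneg _
  have hy1 : Real.exp (-x) ≤ 1 := by rw [Real.exp_le_one_iff]; linarith
  have hP : |P.eval (Real.exp (-x))| ≤ ∑ i ∈ P.support, |P.coeff i| := by
    rw [Polynomial.eval_eq_sum, Polynomial.sum]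
    refine (abs_sum_le_sum_abs _ _).trans (sum_le_sum fun i _ => ?_)
    rw [abs_mul, abs_pow, abs_of_nonneg hy0]
    exact mul_le_of_le_one_right (abs_nonneg _) (pow_le_one₀ hy0 hy1)
  have hQj : 1 ≤ Q.eval (Real.exp (-x)) ^ j := one_le_pow₀ hQ
  rw [expRatio, abs_div, abs_mul, abs_of_nonneg hy0,
      abs_of_pos (by linarith : 0 < Q.eval (Real.exp (-x)) ^ j)]
  refine (div_le_self (by positivity) hQj).trans ?_
  rw [mul_comm]
  exact mul_le_mul_of_nonneg_right hP hy0

theorem expRatio_chain (P Q : Polynomial ℝ) (hQ : ∀ x, 0 < Q.eval (Real.exp (-x)))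
    (hQ1 : ∀ x, 0 ≤ x → 1 ≤ Q.eval (Real.exp (-x))) :
    ∃ G₁ G₂ G₃ A, DerivChain (expRatio P Q 1) G₁ G₂ G₃ ∧ Decays A (expRatio P Q 1) G₁ G₂ G₃ := by
  set s : Polynomial ℝ → ℕ → Polynomial ℝ := fun P j => -(P + .X * P.derivative) * Q +
      j * .X * P * Q.derivative
  have hd : ∀ P j x, HasDerivAt (expRatio P Q j) (expRatio (s P j) Q (j + 1) x) x := fun P j x =>
    expRatio_hasDerivAt P Q j (fun x => (hQ x).ne') x
  obtain ⟨A₀, h₀⟩ := expRatio_bound P Q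
  obtain ⟨A₁, h₁⟩ := expRatio_bound (s P 1) Q
  obtain ⟨A₂, h₂⟩ := expRatio_bound (s (s P 1) 2) Q
  obtain ⟨A₃, h₃⟩ := expRatio_bound (s (s (s P 1) 2) 3) Q
  set A := max (max A₀ A₁) (max A₂ A₃)
  have hA : ∀ a, a ≤ A → ∀ x y : ℝ, y ≤ a * Real.exp (-x) → y ≤ A * Real.exp (-x) :=
    fun a ha x y hy => hy.trans (mul_le_mul_of_nonneg_right ha (Real.exp_nonneg _))
  exact ⟨_, _, _, A, ⟨hd P 1, hd _ 2, hd _ 3⟩,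
    ⟨fun x hx => hA A₀ (by simp [A]) _ _ (h₀ _ x hx (hQ1 x hx)),
      fun x hx => hA A₁ (by simp [A]) _ _ (h₁ _ x hx (hQ1 x hx)),
      fun x hx => hA A₂ (by simp [A]) _ _ (h₂ _ x hx (hQ1 x hx)),
      fun x hx => hA A₃ (by simp [A]) _ _ (h₃ _ x hx (hQ1 x hx))⟩⟩

/-- `(e^{-bx} - e^{-Nx}) / (1 - e^{-Nx})` with its singularity at zero removed. -/
theorem exists_residue_function {N b : ℕ} (hb : 0 < b) (hbN : b < N) :
    ∃ G₀ G₁ G₂ G₃ : ℝ → ℝ, ∃ A, DerivChain G₀ G₁ G₂ G₃ ∧ Decays A G₀ G₁ G₂ G₃ ∧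
      G₀ 0 = 1 - b / N ∧ ∀ x, 0 < x →
        G₀ x = (Real.exp (-x) ^ b - Real.exp (-x) ^ N) / (1 - Real.exp (-x) ^ N) := by
  set Q : Polynomial ℝ := ∑ i ∈ range N, .X ^ i with hQd
  set P : Polynomial ℝ := .X ^ (b - 1) * ∑ i ∈ range (N - b), .X ^ i with hPd
  have hQe : ∀ y, Q.eval y = ∑ i ∈ range N, y ^ i := fun y => by simp [Q, Polynomial.eval_finsetSum]
  have hPe : ∀ y, y * P.eval y = y ^ b * ∑ i ∈ range (N - b), y ^ i := fun y => by
    simp only [P, Polynomial.eval_mul, Polynomial.eval_finsetSum, Polynomial.eval_pow,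
        Polynomial.eval_X]
    rw [← mul_assoc, ← pow_succ', Nat.sub_add_cancel hb]
  have hQ1 : ∀ y, 0 ≤ y → 1 ≤ Q.eval y := fun y hy => by
    rw [hQe, ← Nat.sub_add_cancel (show 1 ≤ N by omega), sum_range_succ']
    have : 0 ≤ ∑ k ∈ range (N - 1), y ^ (k + 1) := by positivity
    simpa using this
  obtain ⟨G₁, G₂, G₃, A, hc, hd⟩ := expRatio_chain P Q
    (fun x => zero_lt_one.trans_le (hQ1 _ (Real.exp_nonneg _)))
        (fun x _ => hQ1 _ (Real.exp_nonneg _))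
  refine ⟨_, _, _, _, A, hc, hd, ?_, fun x hx => ?_⟩
  · have hN : (N : ℝ) ≠ 0 := by have : 0 < N := by omega
                                positivity
    simp only [expRatio, hPe, hQe]
    simp [Nat.cast_sub hbN.le]
    field_simp
  · have hy1 : Real.exp (-x) < 1 := by rw [Real.exp_lt_one_iff]; linarith
    simp only [expRatio, hPe, hQe, pow_one]
    set y := Real.exp (-x)
    have hy0 : 0 < y := Real.exp_pos _
    have hyN : y ^ N < 1 := pow_lt_one₀ hy0.le hy1 (by omega)
    rw [geom_sum_eq hy1.ne, geom_sum_eq hy1.ne]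
    have h1 : y - 1 ≠ 0 := by linarith
    have h2 : y ^ N - 1 ≠ 0 := by linarith
    have h3 : 1 - y ^ N ≠ 0 := by linarith
    have h4 : y ^ b * y ^ (N - b) = y ^ N := by rw [← pow_add]; congr 1; omega
    field_simp
    linear_combination (1 - y ^ N) * h4

theorem tsum_periodic_mul_pow {N : ℕ} (hN : 0 < N) {p : ℤ → ℝ} (hp : Function.Periodic p N)
    {y : ℝ} (hy0 : 0 ≤ y) (hy1 : y < 1) :
    ∑' l : ℕ, p l * y ^ l = ∑ b ∈ range N, p b * y ^ b / (1 - y ^ N) := by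
  obtain ⟨B, hB0, hB⟩ := exists_periodic_bound hN hp
  have hs : Summable fun l : ℕ => p l * y ^ l := by
    refine Summable.of_norm_bounded ((summable_geometric_of_lt_one hy0 hy1).mul_left B) fun l => ?_
    rw [Real.norm_eq_abs, abs_mul, abs_of_nonneg (pow_nonneg hy0 l)]
    exact mul_le_mul_of_nonneg_right (hB _) (pow_nonneg hy0 l)
  have : NeZero N := ⟨hN.ne'⟩
  rw [Nat.sumByResidueClasses hs N]
  have hyN : y ^ N < 1 := pow_lt_one₀ hy0 hy1 hN.ne'
  have h1 : ∀ j : ZMod N, ∑' m : ℕ, p ((j.val + N * m : ℕ) : ℤ) * y ^ (j.val + N * m) =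
      p j.val * y ^ j.val / (1 - y ^ N) := fun j => by
    rw [div_eq_mul_inv, ← tsum_geometric_of_lt_one (pow_nonneg hy0 N) hyN, ← tsum_mul_left]
    refine tsum_congr fun m => ?_
    have := hp.int_mul m (j.val : ℤ)
    rw [Int.cast_id] at this
    push_cast
    rw [show (j.val : ℤ) + N * m = j.val + m * N by ring, this, pow_add, pow_mul, mul_assoc]
  simp only [h1]
  refine sum_bij (fun j _ => j.val) (fun j _ => mem_range.2 (ZMod.val_lt j))
    (fun _ _ _ _ h => ZMod.val_injective N h)
    (fun b hb => ⟨(b : ZMod N), mem_univ _, ZMod.val_cast_of_lt (mem_range.1 hb)⟩) (fun _ _ => rfl)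

/-- The limit of the smoothed sum of a doubly periodic, doubly odd function over the lattice of
pairs of natural numbers. -/
theorem tendsto_hyperbola {q N : ℕ} (hq : 0 < q) (hN : 0 < N) {v : ℤ → ℤ → ℝ}
    (perX : ∀ a b, v (a + q) b = v a b) (perY : ∀ a b, v a (b + N) = v a b)
    (oddX : ∀ a b, v (-a) b = -v a b) (oddY : ∀ a b, v a (-b) = -v a b) :
    Tendsto (fun t : ℝ => ∑' k : ℕ, ∑' l : ℕ, v k l * Real.exp (-(t * (k * l)))) (𝓝[>] 0)
      (𝓝 (∑ a ∈ range q, ∑ b ∈ range N, v a b * (a * b) / (q * N))) := by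
  have v0 : ∀ b, v 0 b = 0 := fun b => by have := oddX 0 b; rw [neg_zero] at this; linarith
  have v1 : ∀ a, v a 0 = 0 := fun a => by have := oddY a 0; rw [neg_zero] at this; linarith
  have sumX : ∀ b, ∑ a ∈ range q, v a b = 0 := fun b => by
    have h := sum_reflect (p := fun a => v a b) (fun a => perX a b) (fun _ => 1)
    simp only [mul_one, sub_self, mul_zero, add_zero, oddX, sum_neg_distrib] at h
    linarith
  have sumY : ∀ a, ∑ b ∈ range N, v a b = 0 := fun a => by
    have h := sum_reflect (p := v a) (perY a) (fun _ => 1)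
    simp only [mul_one, sub_self, mul_zero, add_zero, oddY, sum_neg_distrib] at h
    linarith
  have hG : ∀ b : ℕ, ∃ G : ℝ → ℝ, (0 < b → b < N → ∀ x, 0 < x →
      G x = (Real.exp (-x) ^ b - Real.exp (-x) ^ N) / (1 - Real.exp (-x) ^ N)) ∧
      ∃ C, ∀ u, 0 < u → u ≤ 1 → b < N → Summable (fun k : ℕ => v k b * G (u * k)) ∧
        |∑' k : ℕ, v k b * G (u * k) + (∑ a ∈ range q, v a b * a / q) * (1 - b / N)| ≤ C * u := by
    intro b
    by_cases hb : 0 < b ∧ b < N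
    · obtain ⟨G₀, G₁, G₂, G₃, A, hc, hd, h0, hx⟩ := exists_residue_function hb.1 hb.2
      have hm : mean q (fun a => v a b) = 0 := by simp only [mean, sumX, zero_div]
      obtain ⟨C, hC⟩ := euler_maclaurin_tsum hq (p := fun a => v a b) (fun a => perX a b) hc hd
        (Φ := fun _ => 0)
        (fun x => (hasDerivAt_const x (0 : ℝ)).congr_deriv (by rw [hm, zero_mul]))
            tendsto_const_nhds
      have he : edge q (fun a => v a b) 0 = ∑ a ∈ range q, v a b * a / q := by
        have : ∑ a ∈ range q, v a b * (1 / 2 : ℝ) = 0 := by rw [← sum_mul, sumX, zero_mul]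
        simp only [edge, shiftSum, β₁, v0, zero_add, mul_sub, sum_sub_distrib, this, mul_div_assoc]
        simp
      set c := shiftSum q (β₂ q) (fun a => v a b) 0 * G₁ 0
      refine ⟨G₀, fun _ _ => hx, |C| + |c|, fun u hu hu1 _ => ⟨(hC u hu hu1).1, ?_⟩⟩
      have h := (hC u hu hu1).2
      rw [he, h0] at h
      simp only [v0, zero_mul, zero_div, sub_zero] at h
      have h2 : C * u ^ 2 ≤ |C| * u := by
        have : C * u ^ 2 ≤ |C| * u ^ 2 := mul_le_mul_of_nonneg_right (le_abs_self C) (by positivity)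
        have : |C| * u ^ 2 ≤ |C| * u := mul_le_mul_of_nonneg_left (by nlinarith) (abs_nonneg C)
        linarith
      have h3 : |u * c| = |c| * u := by rw [abs_mul, abs_of_pos hu, mul_comm]
      have h4 := abs_sub (∑' k : ℕ, v k b * G₀ (u * k) +
        (∑ a ∈ range q, v a b * a / q) * (1 - b / N) + u * c) (u * c)
      rw [add_sub_cancel_right, h3] at h4
      linarith
    · refine ⟨fun _ => 0, fun h h' => absurd ⟨h, h'⟩ hb, 0, fun u hu hu1 hbN => ?_⟩
      have : b = 0 := by omega
      subst this
      simp [v1]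
  choose G hGx C hC using hG
  have key : ∀ u, 0 < u → u ≤ 1 → ∑' k : ℕ, ∑' l : ℕ, v k l * Real.exp (-(u * (k * l))) =
      ∑ b ∈ range N, ∑' k : ℕ, v k b * G b (u * k) := by
    intro u hu hu1
    rw [← Summable.tsum_finsetSum fun b hb => (hC b u hu hu1 (mem_range.1 hb)).1]
    refine tsum_congr fun k => ?_
    rcases Nat.eq_zero_or_pos k with rfl | hk
    · simp [v0]
    have hx : 0 < u * k := by positivity
    have hy1 : Real.exp (-(u * k)) < 1 := by rw [Real.exp_lt_one_iff]; linarith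
    have h1 : ∀ l : ℕ, Real.exp (-(u * (k * l))) = Real.exp (-(u * k)) ^ l := fun l => by
      rw [← Real.exp_nat_mul]; congr 1; ring
    simp only [h1]
    rw [tsum_periodic_mul_pow hN (perY k) (Real.exp_nonneg _) hy1]
    set y := Real.exp (-(u * k))
    have h2 : ∑ b ∈ range N, v k b * (y ^ N / (1 - y ^ N)) = 0 := by rw [← sum_mul, sumY, zero_mul]
    rw [← sub_zero (∑ b ∈ range N, v k b * y ^ b / (1 - y ^ N)), ← h2, ← sum_sub_distrib]
    refine sum_congr rfl fun b hb => ?_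
    rcases Nat.eq_zero_or_pos b with rfl | hb0
    · simp [v1]
    rw [hGx b hb0 (mem_range.1 hb) _ hx]
    ring
  have hlim : ∑ a ∈ range q, ∑ b ∈ range N, v a b * (a * b) / (q * N) =
      ∑ b ∈ range N, -((∑ a ∈ range q, v a b * a / q) * (1 - b / N)) := by
    have h1 : ∑ b ∈ range N, ∑ a ∈ range q, v a b * a / q = 0 := by
      rw [sum_comm]
      refine sum_eq_zero fun a _ => ?_
      rw [← sum_div, ← sum_mul, sumY, zero_mul, zero_div]
    rw [sum_comm, ← sub_zero (∑ b ∈ range N, ∑ a ∈ range q, _), ← h1, ← sum_sub_distrib]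
    refine sum_congr rfl fun b _ => ?_
    rw [sum_mul, ← sum_neg_distrib, ← sum_sub_distrib]
    refine sum_congr rfl fun a _ => ?_
    field_simp
    ring
  have hev : ∀ᶠ u : ℝ in 𝓝[>] 0, 0 < u ∧ u ≤ 1 := by
    filter_upwards [Ioc_mem_nhdsGT (show (0 : ℝ) < 1 by norm_num)] with u hu using hu
  rw [hlim]
  refine Tendsto.congr' (hev.mono fun u hu => (key u hu.1 hu.2).symm)
    (tendsto_finsetSum _ fun b hb => ?_)
  rw [tendsto_iff_norm_sub_tendsto_zero]
  have hl : Tendsto (fun u : ℝ => C b * u) (𝓝[>] 0) (𝓝 0) := by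
    have : Tendsto (fun u : ℝ => C b * u) (𝓝 0) (𝓝 (C b * 0)) := Continuous.tendsto (by fun_prop) 0
    simpa using this.mono_left nhdsWithin_le_nhds
  refine squeeze_zero' (Eventually.of_forall fun _ => norm_nonneg _) ?_ hl
  filter_upwards [hev] with u hu
  rw [sub_neg_eq_add]
  exact (hC b u hu.1 hu.2 (mem_range.1 hb)).2

/-! ### Norms and cones in the order generated by a root of `ω² = 1 + n ω` -/

/-- The quadratic order generated by a root `ω` of `ω² = 1 + n ω`. -/
abbrev Order (n : ℕ) := QuadraticAlgebra ℤ 1 (n : ℤ)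

/-- Classes up to units of the elements whose norm has absolute value `m`. -/
def classes (n m : ℕ) : Set (Associates (Order n)) :=
  Associates.mk '' {x | (QuadraticAlgebra.norm x).natAbs = m}

/-- The lattice points of norm `m` in the fundamental cone. -/
def cone (n m : ℕ) : Finset (ℕ × ℕ) :=
  (range (m + 1) ×ˢ range (n * m + 1)).filter
    fun z => z.2 < n * z.1 ∧ z.1 ^ 2 + n * z.1 * z.2 = m + z.2 ^ 2

theorem norm_eq {n : ℕ} (x : Order n) :
    QuadraticAlgebra.norm x = x.re ^ 2 + n * x.re * x.im - x.im ^ 2 := by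
  rw [QuadraticAlgebra.norm_def]; ring

theorem mk_mem_classes {n m : ℕ} {x : Order n} :
    Associates.mk x ∈ classes n m ↔ (QuadraticAlgebra.norm x).natAbs = m := by
  constructor
  · rintro ⟨y, hy, hyx⟩
    obtain ⟨u, hu⟩ := Associates.mk_eq_mk_iff_associated.1 hyx
    have h1 : (QuadraticAlgebra.norm (u : Order n)).natAbs = 1 :=
      Int.isUnit_iff_natAbs_eq.1 (QuadraticAlgebra.isUnit_iff_norm_isUnit.1 u.isUnit)
    rw [← hu, map_mul, Int.natAbs_mul, h1, mul_one]
    exact hy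
  · exact fun h => ⟨x, h, rfl⟩

theorem mem_cone {n m X Y : ℕ} :
    (X, Y) ∈ cone n m ↔ Y < n * X ∧ X ^ 2 + n * X * Y = m + Y ^ 2 := by
  simp only [cone, mem_filter, mem_product, mem_range, and_iff_right_iff_imp]
  rintro ⟨h1, h2⟩
  have h3 : X ^ 2 ≤ m := by nlinarith
  have h4 : X ≤ m := by nlinarith [sq_nonneg X, Nat.le_self_pow two_ne_zero X]
  constructor
  · omega
  · nlinarith

/-- Descent into the cone. -/
theorem exists_cone_associated {n m : ℕ} (hn : 0 < n) (hm : 0 < m) (x : Order n) (hx : 0 < x.re)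
    (hN : QuadraticAlgebra.norm x = m) :
    ∃ z ∈ cone n m, Associated x (⟨z.1, z.2⟩ : Order n) := by
  have hn' : (0 : ℤ) < n := by exact_mod_cast hn
  have hmul (x y : Order n) (u : ℤ × ℤ) (hu : u.1 ^ 2 + n * u.1 * u.2 - u.2 ^ 2 = 1)
      (hy : y = x * ⟨u.1, u.2⟩) : Associated x y := by
    have h : IsUnit (⟨u.1, u.2⟩ : Order n) := by
      rw [QuadraticAlgebra.isUnit_iff_norm_isUnit, norm_eq]
      simp only
      rw [hu]
      exact isUnit_one
    exact ⟨h.unit, hy.symm⟩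
  induction hk : x.im.natAbs using Nat.strong_induction_on generalizing x with
  | _ k ih =>
    have hm' : (0 : ℤ) < m := by exact_mod_cast hm
    rw [norm_eq] at hN
    by_cases h0 : 0 ≤ x.im
    · by_cases h1 : x.im < n * x.re
      · refine ⟨(x.re.toNat, x.im.toNat), ?_, ?_⟩
        · rw [mem_cone]
          zify
          rw [Int.toNat_of_nonneg h0, Int.toNat_of_nonneg hx.le]
          exact ⟨h1, by linarith⟩
        · rw [Int.toNat_of_nonneg h0, Int.toNat_of_nonneg hx.le]
      · have hx' : 0 < x.re - n * (x.im - n * x.re) := by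
          nlinarith [sq_nonneg (x.im - n * x.re)]
        obtain ⟨z, hz, ha⟩ := ih (x.im - n * x.re).natAbs (by
          have : 0 < n * x.re := by positivity
          omega) ⟨x.re - n * (x.im - n * x.re), x.im - n * x.re⟩ hx' (by
            rw [norm_eq]; simp only; rw [← hN]; ring) rfl
        refine ⟨z, hz, (hmul x _ (1 + (n : ℤ) ^ 2, -n) (by ring) ?_).trans ha⟩
        ext <;> simp [QuadraticAlgebra.re_mul, QuadraticAlgebra.im_mul] <;> ring
    · have hx' : 0 < x.re + n * x.im := by
        nlinarith [sq_nonneg x.im]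
      by_cases h2 : 0 ≤ x.im + n * (x.re + n * x.im)
      · refine ⟨((x.re + n * x.im).toNat, (x.im + n * (x.re + n * x.im)).toNat), ?_, ?_⟩
        · rw [mem_cone]
          zify
          rw [Int.toNat_of_nonneg h2, Int.toNat_of_nonneg hx'.le]
          exact ⟨by linarith, by linarith⟩
        · rw [Int.toNat_of_nonneg h2, Int.toNat_of_nonneg hx'.le]
          refine hmul x _ (1, n) (by ring) ?_
          ext <;> simp [QuadraticAlgebra.re_mul, QuadraticAlgebra.im_mul] <;> ring
      · obtain ⟨z, hz, ha⟩ := ih (x.im + n * (x.re + n * x.im)).natAbs (by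
          have : 0 < n * (x.re + n * x.im) := by positivity
          omega) ⟨x.re + n * x.im, x.im + n * (x.re + n * x.im)⟩ hx' (by
            rw [norm_eq]; simp only; rw [← hN]; ring) rfl
        refine ⟨z, hz, (hmul x _ (1, (n : ℤ)) (by ring) ?_).trans ha⟩
        ext <;> simp [QuadraticAlgebra.re_mul, QuadraticAlgebra.im_mul] <;> ring

theorem eq_of_mem_cone_of_unit {n m : ℕ} (hm : 0 < m) {x y x' y' : ℕ}
    (h : (x, y) ∈ cone n m) (h' : (x', y') ∈ cone n m) (e f : ℤ) (hf : 0 ≤ f)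
    (hN : e ^ 2 + n * e * f - f ^ 2 = 1)
    (he : (m : ℤ) * e = x' * x + n * x' * y - y' * y) (hf' : (m : ℤ) * f = y' * x - x' * y) :
    (x, y) = (x', y') := by
  rw [mem_cone] at h h'
  zify at h h'
  obtain ⟨h1, h2⟩ := h
  obtain ⟨h3, h4⟩ := h'
  have hm' : (0 : ℤ) < m := by exact_mod_cast hm
  have hn : (0 : ℤ) ≤ n := by positivity
  have hx : (0 : ℤ) < x := by
    by_contra! hc
    nlinarith [(Nat.cast_nonneg y : (0 : ℤ) ≤ y)]
  have hx' : (0 : ℤ) < x' := by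
    by_contra! hc
    nlinarith [(Nat.cast_nonneg y' : (0 : ℤ) ≤ y')]
  have hy : (0 : ℤ) ≤ y := by positivity
  have hy' : (0 : ℤ) ≤ y' := by positivity
  have hP : 0 < (m : ℤ) * e := by
    rw [he]
    nlinarith [mul_nonneg hy (sub_nonneg.2 h3.le), mul_pos hx hx']
  have he0 : 0 < e := pos_of_mul_pos_right hP hm'.le
  rcases hf.eq_or_lt with rfl | hf
  · have he1 : e = 1 := by nlinarith
    subst he1
    have h5 : (m : ℤ) * x = m * x' := by linear_combination x * he + x' * h2 + y * hf'
    have h6 : (x : ℤ) = x' := mul_left_cancel₀ hm'.ne' h5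
    have h7 : (x : ℤ) * y = x * y' := by rw [← h6] at hf'; linarith
    have h8 : (y : ℤ) = y' := mul_left_cancel₀ hx.ne' h7
    rw [Nat.cast_inj.1 h6, Nat.cast_inj.1 h8]
  · exfalso
    have h5 : n * e ≤ f := by
      by_contra! hc
      nlinarith [mul_pos hf (sub_pos.2 hc)]
    have h6 : (m : ℤ) * f < m * (n * e) := by
      have : (m : ℤ) * (n * e) = n * x' * x + n * (y * (n * x' - y')) := by
        linear_combination n * he
      rw [hf', this]
      have h7 : (y' : ℤ) * x < n * x' * x := mul_lt_mul_of_pos_right h3 hx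
      have h8 : 0 ≤ n * ((y : ℤ) * (n * x' - y')) :=
        mul_nonneg hn (mul_nonneg hy (sub_nonneg.2 h3.le))
      nlinarith
    exact absurd (lt_of_mul_lt_mul_left h6 hm'.le) (not_lt.2 h5)

theorem eq_of_mem_cone_of_associated {n m : ℕ} (hm : 0 < m) {z z' : ℕ × ℕ}
    (h : z ∈ cone n m) (h' : z' ∈ cone n m)
    (ha : Associated (⟨z.1, z.2⟩ : Order n) (⟨z'.1, z'.2⟩ : Order n)) : z = z' := by
  obtain ⟨x, y⟩ := z
  obtain ⟨x', y'⟩ := z'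
  obtain ⟨u, hu⟩ := ha
  obtain ⟨e, f, hu'⟩ : ∃ e f : ℤ, (u : Order n) = ⟨e, f⟩ := ⟨_, _, rfl⟩
  rw [hu'] at hu
  have h1 := congrArg QuadraticAlgebra.re hu
  have h2 := congrArg QuadraticAlgebra.im hu
  simp only [QuadraticAlgebra.re_mul, QuadraticAlgebra.im_mul] at h1 h2
  have hc := (mem_cone.1 h).2
  have hc' := (mem_cone.1 h').2
  zify at hc hc'
  have hm' : (m : ℤ) ≠ 0 := by exact_mod_cast hm.ne'
  have hN : e ^ 2 + n * e * f - f ^ 2 = 1 := by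
    refine mul_left_cancel₀ hm' ?_
    linear_combination (e ^ 2 + n * e * f - f ^ 2) * (-hc) + hc' +
      (x * e + 1 * y * f + x' + n * y') * h1
          + (n * (x * e + y * f) - (x * f + y * e + n * y * f) - y') * h2
  have he : (m : ℤ) * e = x' * x + n * x' * y - y' * y := by
    rw [← h1, ← h2]; linear_combination -e * hc
  have hf : (m : ℤ) * f = y' * x - x' * y := by
    rw [← h1, ← h2]; linear_combination -f * hc
  rcases le_total 0 f with h0 | h0
  · exact eq_of_mem_cone_of_unit hm h h' e f h0 hN he hf
  · exact (eq_of_mem_cone_of_unit hm h' h (e + n * f) (-f) (by linarith)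
      (by linear_combination hN) (by linear_combination he + n * hf)
          (by linear_combination -hf)).symm

theorem exists_cone_associated_of_natAbs {n m : ℕ} (hn : 0 < n) (hm : 0 < m) {x : Order n}
    (hx : (QuadraticAlgebra.norm x).natAbs = m) :
    ∃ z ∈ cone n m, Associated x (⟨z.1, z.2⟩ : Order n) := by
  have hω : IsUnit (⟨0, 1⟩ : Order n) := by
    rw [QuadraticAlgebra.isUnit_iff_norm_isUnit, norm_eq]
    simp
  obtain ⟨y, hxy, hy⟩ : ∃ y, Associated x y ∧ QuadraticAlgebra.norm y = m := by
    rcases Int.natAbs_eq (QuadraticAlgebra.norm x) with h | h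
    · exact ⟨x, Associated.refl x, by rw [h, hx]⟩
    · refine ⟨x * ⟨0, 1⟩, ⟨hω.unit, rfl⟩, ?_⟩
      rw [map_mul, norm_eq ⟨0, 1⟩, h, hx]
      simp
  obtain ⟨w, hyw, hw, hw0⟩ : ∃ w, Associated y w ∧ QuadraticAlgebra.norm w = m ∧ 0 < w.re := by
    have h0 : y.re ≠ 0 := by
      intro h0
      rw [norm_eq, h0] at hy
      nlinarith [sq_nonneg y.im]
    rcases lt_or_gt_of_ne h0 with h | h
    · exact ⟨-y, (Associated.refl y).neg_right, by rw [QuadraticAlgebra.norm_neg, hy], by simpa⟩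
    · exact ⟨y, Associated.refl y, hy, h⟩
  obtain ⟨z, hz, hwz⟩ := exists_cone_associated hn hm w hw0 hw
  exact ⟨z, hz, hxy.trans (hyw.trans hwz)⟩

theorem finite_classes {n m : ℕ} (hn : 0 < n) (hm : 0 < m) : (classes n m).Finite := by
  refine ((cone n m).finite_toSet.image fun z => Associates.mk (⟨z.1, z.2⟩ : Order n)).subset ?_
  rintro _ ⟨x, hx, rfl⟩
  obtain ⟨z, hz, hxz⟩ := exists_cone_associated_of_natAbs hn hm hx
  exact ⟨z, hz, Associates.mk_eq_mk_iff_associated.2 hxz.symm⟩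

theorem ncard_classes {n m : ℕ} (hn : 0 < n) (hm : 0 < m) :
    (classes n m).ncard = #(cone n m) := by
  rw [← Set.ncard_coe_finset]
  symm
  refine Set.ncard_congr (fun z _ => Associates.mk (⟨z.1, z.2⟩ : Order n)) ?_ ?_ ?_
  · rintro ⟨x, y⟩ h
    have hc := (mem_cone.1 (mem_coe.1 h)).2
    zify at hc
    rw [mk_mem_classes, norm_eq]
    have : (x : ℤ) ^ 2 + n * x * y - y ^ 2 = m := by linarith
    simp [this]
  · intro z z' h h' ha
    exact eq_of_mem_cone_of_associated hm (mem_coe.1 h) (mem_coe.1 h')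
      (Associates.mk_eq_mk_iff_associated.1 ha)
  · rintro _ ⟨x, hx, rfl⟩
    obtain ⟨z, hz, hxz⟩ := exists_cone_associated_of_natAbs hn hm hx
    exact ⟨z, mem_coe.2 hz, Associates.mk_eq_mk_iff_associated.2 hxz.symm⟩

theorem ncard_classes_one {n : ℕ} (hn : 0 < n) : (classes n 1).ncard = 1 := by
  rw [ncard_classes hn one_pos]
  refine card_eq_one.2 ⟨(1, 0), ?_⟩
  ext ⟨x, y⟩
  rw [mem_cone, mem_singleton, Prod.mk.injEq]
  constructor
  · rintro ⟨h1, h2⟩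
    have hx : 0 < x := Nat.pos_of_ne_zero (by rintro rfl; simp at h1)
    have h3 : x ^ 2 ≤ 1 := by nlinarith
    have h4 : x = 1 := by nlinarith
    subst h4
    refine ⟨rfl, ?_⟩
    by_contra hy
    have hy' : 0 < y := Nat.pos_of_ne_zero hy
    nlinarith
  · rintro ⟨rfl, rfl⟩
    simpa using hn

/-! ### Elements of given norm -/

theorem mul_left_cancel_of_norm {n : ℕ} {π x y : Order n} (hπ : QuadraticAlgebra.norm π ≠ 0)
    (h : π * x = π * y) : x = y := by
  have h1 : algebraMap ℤ (Order n) (QuadraticAlgebra.norm π) * x =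
      algebraMap ℤ (Order n) (QuadraticAlgebra.norm π) * y := by
    rw [QuadraticAlgebra.algebraMap_norm_eq_mul_star, mul_comm π, mul_assoc, h, mul_assoc]
  rw [← Algebra.smul_def, ← Algebra.smul_def] at h1
  have h2 := congrArg QuadraticAlgebra.re h1
  have h3 := congrArg QuadraticAlgebra.im h1
  simp only [QuadraticAlgebra.re_smul, QuadraticAlgebra.im_smul, smul_eq_mul] at h2 h3
  exact QuadraticAlgebra.ext (mul_left_cancel₀ hπ h2) (mul_left_cancel₀ hπ h3)

theorem ncard_dvd {n p m : ℕ} {π : Order n} (hπ : (QuadraticAlgebra.norm π).natAbs = p)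
    (hp : p ≠ 0) :
    {b ∈ classes n (p * m) | Associates.mk π ∣ b}.ncard = (classes n m).ncard := by
  have h0 : QuadraticAlgebra.norm π ≠ 0 := by
    intro h
    rw [h] at hπ
    exact hp hπ.symm
  symm
  refine Set.ncard_congr (fun a _ => Associates.mk π * a) ?_ ?_ ?_
  · rintro _ ⟨x, hx, rfl⟩
    refine ⟨?_, dvd_mul_right _ _⟩
    rw [Associates.mk_mul_mk, mk_mem_classes, map_mul, Int.natAbs_mul, hπ, hx]
  · rintro _ _ ⟨x, hx, rfl⟩ ⟨y, hy, rfl⟩ h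
    simp only [Associates.mk_mul_mk] at h
    obtain ⟨u, hu⟩ := Associates.mk_eq_mk_iff_associated.1 h
    rw [mul_assoc] at hu
    exact Associates.mk_eq_mk_iff_associated.2 ⟨u, mul_left_cancel_of_norm h0 hu⟩
  · rintro _ ⟨⟨x, hx, rfl⟩, hd⟩
    obtain ⟨y, rfl⟩ := Associates.mk_dvd_mk.1 hd
    refine ⟨Associates.mk y, ?_, Associates.mk_mul_mk⟩
    rw [Set.mem_ofPred_eq, map_mul, Int.natAbs_mul, hπ] at hx
    exact mk_mem_classes.2 (Nat.eq_of_mul_eq_mul_left (Nat.pos_of_ne_zero hp) hx)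

theorem ncard_natCast_dvd {n p m : ℕ} (hp : p.Prime) :
    {b ∈ classes n (p * m) | Associates.mk (p : Order n) ∣ b}.ncard =
      if p ∣ m then (classes n (m / p)).ncard else 0 := by
  have hN : (QuadraticAlgebra.norm (p : Order n)).natAbs = p * p := by
    rw [QuadraticAlgebra.norm_natCast, ← Nat.cast_pow, Int.natAbs_natCast, sq]
  split_ifs with h
  · obtain ⟨k, rfl⟩ := h
    rw [Nat.mul_div_cancel_left _ hp.pos, ← mul_assoc]
    exact ncard_dvd hN (by simp [hp.ne_zero])
  · rw [← Set.ncard_empty (Associates (Order n))]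
    congr 1
    refine Set.eq_empty_of_forall_notMem ?_
    rintro _ ⟨⟨x, hx, rfl⟩, hd⟩
    obtain ⟨y, rfl⟩ := Associates.mk_dvd_mk.1 hd
    rw [Set.mem_ofPred_eq, map_mul, Int.natAbs_mul, hN, mul_assoc] at hx
    exact h ⟨_, (Nat.eq_of_mul_eq_mul_left hp.pos hx).symm⟩

theorem not_dvd_im {n p : ℕ} (hp : p.Prime) {π : Order n}
    (hπ : (QuadraticAlgebra.norm π).natAbs = p) : ¬ (p : ℤ) ∣ π.im := by
  have hp' : Prime (p : ℤ) := Nat.prime_iff_prime_int.1 hp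
  intro h
  have hpN : (p : ℤ) ∣ QuadraticAlgebra.norm π := Int.natCast_dvd.2 hπ.symm.dvd
  have h1 : (p : ℤ) ∣ π.re := by
    refine hp'.dvd_of_dvd_pow (n := 2) ?_
    have : π.re ^ 2 = QuadraticAlgebra.norm π - π.im * (n * π.re - π.im) := by rw [norm_eq]; ring
    rw [this]
    exact dvd_sub hpN (h.mul_right _)
  obtain ⟨s, hs⟩ := h
  obtain ⟨t, ht⟩ := h1
  have h2 : (p : ℤ) * p ∣ QuadraticAlgebra.norm π :=
    ⟨t ^ 2 + n * t * s - s ^ 2, by rw [norm_eq, hs, ht]; ring⟩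
  rw [← Nat.cast_mul, Int.natCast_dvd, hπ] at h2
  have := Nat.le_of_dvd hp.pos h2
  nlinarith [hp.one_lt]

/-- Divisibility by an element of prime norm. -/
theorem dvd_iff_of_norm_prime {n p : ℕ} (hp : p.Prime) {π x : Order n}
    (hπ : (QuadraticAlgebra.norm π).natAbs = p) :
    π ∣ x ↔ (p : ℤ) ∣ x.re * π.im - π.re * x.im := by
  have hp' : Prime (p : ℤ) := Nat.prime_iff_prime_int.1 hp
  have hN := norm_eq π
  have hpN : (p : ℤ) ∣ QuadraticAlgebra.norm π := Int.natCast_dvd.2 hπ.symm.dvd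
  have hNp : QuadraticAlgebra.norm π ∣ (p : ℤ) := Int.dvd_natCast.2 hπ.dvd
  have h0 : QuadraticAlgebra.norm π ≠ 0 := by
    intro h
    rw [h] at hπ
    exact hp.ne_zero hπ.symm
  constructor
  · rintro ⟨y, rfl⟩
    have : (π * y).re * π.im - π.re * (π * y).im = QuadraticAlgebra.norm π * -y.im := by
      simp only [QuadraticAlgebra.re_mul, QuadraticAlgebra.im_mul, hN]
      ring
    rw [this]
    exact hpN.mul_right _
  · intro h
    have h1 : (p : ℤ) ∣ x.re * (π.re + n * π.im) - x.im * π.im := by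
      refine (hp'.dvd_or_dvd ?_).resolve_left (not_dvd_im hp hπ)
      have : π.im * (x.re * (π.re + n * π.im) - x.im * π.im) =
          (x.re * π.im - π.re * x.im) * (π.re + n * π.im) + x.im * QuadraticAlgebra.norm π := by
        rw [hN]; ring
      rw [this]
      exact dvd_add (h.mul_right _) (hpN.mul_left _)
    obtain ⟨s, hs⟩ := hNp.trans h1
    obtain ⟨t, ht⟩ := hNp.trans h
    refine ⟨⟨s, -t⟩, ?_⟩
    ext
    · refine mul_left_cancel₀ h0 ?_
      simp only [QuadraticAlgebra.re_mul]
      linear_combination x.re * hN + π.re * hs - π.im * ht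
    · refine mul_left_cancel₀ h0 ?_
      simp only [QuadraticAlgebra.im_mul]
      linear_combination x.im * hN + π.im * hs - (π.re + n * π.im) * ht

theorem dvd_or_star_dvd {n p : ℕ} (hp : p.Prime) {π x : Order n}
    (hπ : (QuadraticAlgebra.norm π).natAbs = p) (hx : (p : ℤ) ∣ QuadraticAlgebra.norm x) :
    π ∣ x ∨ star π ∣ x := by
  have hp' : Prime (p : ℤ) := Nat.prime_iff_prime_int.1 hp
  have hpN : (p : ℤ) ∣ QuadraticAlgebra.norm π := Int.natCast_dvd.2 hπ.symm.dvd
  rw [dvd_iff_of_norm_prime hp hπ, dvd_iff_of_norm_prime hp (π := star π)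
    (by rw [QuadraticAlgebra.norm_star, hπ])]
  refine hp'.dvd_or_dvd ?_
  have : (x.re * π.im - π.re * x.im) * (x.re * (star π).im - (star π).re * x.im) =
      x.im ^ 2 * QuadraticAlgebra.norm π - π.im ^ 2 * QuadraticAlgebra.norm x := by
    rw [norm_eq, norm_eq, QuadraticAlgebra.re_star, QuadraticAlgebra.im_star]
    ring
  rw [this]
  exact dvd_sub (hpN.mul_left _) (hx.mul_left _)

theorem natCast_dvd_iff {n p : ℕ} {x : Order n} :
    (p : Order n) ∣ x ↔ (p : ℤ) ∣ x.re ∧ (p : ℤ) ∣ x.im := by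
  constructor
  · rintro ⟨y, rfl⟩
    simp [QuadraticAlgebra.re_mul, QuadraticAlgebra.im_mul]
  · rintro ⟨⟨s, hs⟩, ⟨t, ht⟩⟩
    refine ⟨⟨s, t⟩, ?_⟩
    ext
    · simp [hs]
    · simp [ht]

theorem ncard_classes_split {n p m : ℕ} (hn : 0 < n) (hm : 0 < m) (hp : p.Prime) {π : Order n}
    (hπ : (QuadraticAlgebra.norm π).natAbs = p) (hd : ¬ (p : ℤ) ∣ 2 * π.re + n * π.im) :
    (classes n (p * m)).ncard + (if p ∣ m then (classes n (m / p)).ncard else 0) =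
      2 * (classes n m).ncard := by
  have hp' : Prime (p : ℤ) := Nat.prime_iff_prime_int.1 hp
  have hπ' : (QuadraticAlgebra.norm (star π)).natAbs = p := by rw [QuadraticAlgebra.norm_star, hπ]
  have hf := finite_classes hn (Nat.mul_pos hp.pos hm)
  have h := Set.ncard_union_add_ncard_inter
    {b ∈ classes n (p * m) | Associates.mk π ∣ b}
        {b ∈ classes n (p * m) | Associates.mk (star π) ∣ b}
    (hf.subset fun _ h => h.1) (hf.subset fun _ h => h.1)
  rw [ncard_dvd hπ hp.ne_zero, ncard_dvd hπ' hp.ne_zero, ← two_mul] at h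
  rw [← h, ← ncard_natCast_dvd hp]
  congr 2
  · ext b
    constructor
    · rintro ⟨x, hx, rfl⟩
      have h1 : Associates.mk x ∈ classes n (p * m) := mk_mem_classes.2 hx
      have h2 : (p : ℤ) ∣ QuadraticAlgebra.norm x := Int.natCast_dvd.2 ⟨m, hx⟩
      rcases dvd_or_star_dvd hp hπ h2 with h3 | h3
      · exact Or.inl ⟨h1, Associates.mk_dvd_mk.2 h3⟩
      · exact Or.inr ⟨h1, Associates.mk_dvd_mk.2 h3⟩
    · rintro (h | h) <;> exact h.1
  · ext b
    have key (x : Order n) : (p : Order n) ∣ x ↔ π ∣ x ∧ star π ∣ x := by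
      rw [natCast_dvd_iff, dvd_iff_of_norm_prime hp hπ, dvd_iff_of_norm_prime hp hπ',
        QuadraticAlgebra.re_star, QuadraticAlgebra.im_star]
      constructor
      · rintro ⟨h1, h2⟩
        exact ⟨dvd_sub (h1.mul_right _) (h2.mul_left _), dvd_sub (h1.mul_right _) (h2.mul_left _)⟩
      · rintro ⟨h1, h2⟩
        have h3 : (p : ℤ) ∣ x.im := by
          refine (hp'.dvd_or_dvd ?_).resolve_left hd
          have := dvd_neg.2 (dvd_add h1 h2)
          convert this using 1
          ring
        refine ⟨?_, h3⟩
        refine (hp'.dvd_or_dvd ?_).resolve_right (not_dvd_im hp hπ)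
        have := dvd_add h1 (h3.mul_left π.re)
        convert this using 1
        ring
    constructor
    · rintro ⟨⟨x, hx, rfl⟩, h⟩
      have h1 : Associates.mk x ∈ classes n (p * m) := mk_mem_classes.2 hx
      have h2 := (key x).1 (Associates.mk_dvd_mk.1 h)
      exact ⟨⟨h1, Associates.mk_dvd_mk.2 h2.1⟩, ⟨h1, Associates.mk_dvd_mk.2 h2.2⟩⟩
    · rintro ⟨⟨⟨x, hx, rfl⟩, h1⟩, ⟨-, h2⟩⟩
      exact ⟨mk_mem_classes.2 hx, Associates.mk_dvd_mk.2 ((key x).2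
        ⟨Associates.mk_dvd_mk.1 h1, Associates.mk_dvd_mk.1 h2⟩)⟩

theorem ncard_classes_ramified {n p m : ℕ} (hp : p.Prime) {π : Order n}
    (hπ : (QuadraticAlgebra.norm π).natAbs = p) (hd : star π = -π) :
    (classes n (p * m)).ncard = (classes n m).ncard := by
  rw [← ncard_dvd (m := m) hπ hp.ne_zero]
  congr 1
  ext b
  constructor
  · rintro ⟨x, hx, rfl⟩
    refine ⟨mk_mem_classes.2 hx, Associates.mk_dvd_mk.2 ?_⟩
    have h2 : (p : ℤ) ∣ QuadraticAlgebra.norm x := Int.natCast_dvd.2 ⟨m, hx⟩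
    rcases dvd_or_star_dvd hp hπ h2 with h3 | h3
    · exact h3
    · rwa [hd, neg_dvd] at h3
  · exact fun h => h.1

theorem ncard_classes_inert {n p m : ℕ} (hp : p.Prime)
    (h : ∀ x : Order n, (p : ℤ) ∣ QuadraticAlgebra.norm x → (p : Order n) ∣ x) :
    (classes n (p * m)).ncard = if p ∣ m then (classes n (m / p)).ncard else 0 := by
  rw [← ncard_natCast_dvd hp]
  congr 1
  ext b
  constructor
  · rintro ⟨x, hx, rfl⟩
    exact ⟨mk_mem_classes.2 hx, Associates.mk_dvd_mk.2 (h x (Int.natCast_dvd.2 ⟨m, hx⟩))⟩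
  · exact fun h => h.1

/-! ### Counting elements of given norm by a quadratic character -/

theorem chi_eq_neg_one_two {n : ℕ} (hn : Odd n) [Fact (n ^ 2 + 4).Prime] :
    legendreSym (n ^ 2 + 4) 2 = -1 := by
  have h8 : (n ^ 2 + 4) % 8 = 5 := by
    have : n % 8 = 1 ∨ n % 8 = 3 ∨ n % 8 = 5 ∨ n % 8 = 7 := by
      have := Nat.odd_iff.1 hn
      omega
    rcases this with h | h | h | h <;> simp [Nat.add_mod, Nat.pow_mod, h]
  rw [legendreSym.at_two (by omega), ZMod.χ₈_nat_eq_if_mod_eight, h8]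
  simp
  omega

theorem mod_four_eq_one {n : ℕ} (hn : Odd n) : (n ^ 2 + 4) % 4 = 1 := by
  have : n % 4 = 1 ∨ n % 4 = 3 := by
    have := Nat.odd_iff.1 hn
    omega
  rcases this with h | h <;> simp [Nat.pow_mod, h]

theorem no_root_two : ¬ ∃ z : ZMod 2, z ^ 2 + 1 * z - 1 = 0 := by decide

theorem chi_eq_one_iff {n p : ℕ} (hn : Odd n) [Fact (n ^ 2 + 4).Prime] [Fact p.Prime]
    (hp : p ≠ n ^ 2 + 4) :
    legendreSym (n ^ 2 + 4) p = 1 ↔ ∃ z : ZMod p, z ^ 2 + n * z - 1 = 0 := by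
  rcases eq_or_ne p 2 with rfl | h2
  · rw [Nat.cast_ofNat, chi_eq_neg_one_two hn]
    have h1 : (n : ZMod 2) = 1 := ZMod.natCast_eq_one_iff_odd.2 hn
    rw [h1]
    exact iff_of_false (by decide) no_root_two
  · have h0 : ((n ^ 2 + 4 : ℕ) : ZMod p) ≠ 0 := by
      rw [Ne, ZMod.natCast_eq_zero_iff]
      exact fun h => hp ((Nat.prime_dvd_prime_iff_eq Fact.out Fact.out).1 h)
    have h2' : (2 : ZMod p) ≠ 0 := by
      rw [← Nat.cast_ofNat, Ne, ZMod.natCast_eq_zero_iff]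
      exact fun h => h2 ((Nat.prime_dvd_prime_iff_eq Fact.out Nat.prime_two).1 h)
    have h0' : (((n ^ 2 + 4 : ℕ) : ℤ) : ZMod p) ≠ 0 := by exact_mod_cast h0
    rw [← legendreSym.quadratic_reciprocity_one_mod_four (mod_four_eq_one hn) h2,
      legendreSym.eq_one_iff p h0']
    push_cast
    constructor
    · rintro ⟨s, hs⟩
      refine ⟨(s - n) / 2, ?_⟩
      field_simp
      linear_combination -hs
    · rintro ⟨z, hz⟩
      exact ⟨2 * z + n, by linear_combination -4 * hz⟩

theorem natCast_dvd_of_inert {n p : ℕ} [Fact p.Prime]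
    (h : ∀ z : ZMod p, z ^ 2 + n * z - 1 ≠ 0) (x : Order n)
    (hx : (p : ℤ) ∣ QuadraticAlgebra.norm x) : (p : Order n) ∣ x := by
  rw [norm_eq, ← ZMod.intCast_zmod_eq_zero_iff_dvd] at hx
  rw [natCast_dvd_iff, ← ZMod.intCast_zmod_eq_zero_iff_dvd, ← ZMod.intCast_zmod_eq_zero_iff_dvd]
  push_cast at hx
  have h0 : (x.im : ZMod p) = 0 := by
    by_contra h0
    refine h (x.re / x.im) ?_
    field_simp
    linear_combination hx
  rw [h0] at hx
  exact ⟨by simpa using hx, h0⟩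

theorem exists_int_of_root {n p : ℕ} [Fact p.Prime] (h : ∃ z : ZMod p, z ^ 2 + n * z - 1 = 0) :
    ∃ z : ℤ, (p : ℤ) ∣ z ^ 2 + n * z - 1 := by
  obtain ⟨z, hz⟩ := h
  refine ⟨z.val, ?_⟩
  rw [← ZMod.intCast_zmod_eq_zero_iff_dvd]
  push_cast
  rw [ZMod.natCast_zmod_val, hz]

/-- The recursion satisfied both by the number of classes and by the divisor sums of `χ`. -/
def Recursive (χ : ℕ → ℤ) (F : ℕ → ℤ) : Prop :=
  F 1 = 1 ∧ ∀ p m : ℕ, p.Prime → 0 < m →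
    F (p * m) = (1 + χ p) * F m - χ p * if p ∣ m then F (m / p) else 0

theorem Recursive.unique {χ F G : ℕ → ℤ} (hF : Recursive χ F) (hG : Recursive χ G) (m : ℕ)
    (hm : 0 < m) : F m = G m := by
  induction m using Nat.strong_induction_on with
  | _ m ih =>
  rcases Nat.lt_or_ge 1 m with h1 | h1
  · have hp := Nat.minFac_prime h1.ne'
    obtain ⟨k, hk⟩ := Nat.minFac_dvd m
    set p := m.minFac with hpm
    have hk0 : 0 < k := Nat.pos_of_ne_zero (by rintro rfl; omega)
    have hkm : k < m := by nlinarith [hp.two_le]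
    rw [hk, hF.2 p k hp hk0, hG.2 p k hp hk0, ih k hkm hk0]
    split_ifs with h
    · rw [ih (k / p) ((Nat.div_le_self k p).trans_lt hkm)
        (Nat.div_pos (Nat.le_of_dvd hk0 h) hp.pos)]
    · rfl
  · obtain rfl : m = 1 := by omega
    rw [hF.1, hG.1]

theorem recursive_sum_divisors {χ : ℕ → ℤ} (h1 : χ 1 = 1) (hmul : ∀ a b, χ (a * b) = χ a * χ b) :
    Recursive χ fun m => ∑ e ∈ m.divisors, χ e := by
  refine ⟨by simp [h1], fun p m hp hm => ?_⟩
  have h := Finset.sum_union_inter (s₁ := m.divisors) (s₂ := m.divisors.image (p * ·)) (f := χ)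
  have himg (s : Finset ℕ) : ∑ e ∈ s.image (p * ·), χ e = χ p * ∑ e ∈ s, χ e := by
    rw [sum_image fun a _ b _ h => Nat.eq_of_mul_eq_mul_left hp.pos h, mul_sum]
    exact sum_congr rfl fun e _ => hmul p e
  have hun : m.divisors ∪ m.divisors.image (p * ·) = (p * m).divisors := by
    ext e
    simp only [mem_union, mem_image, Nat.mem_divisors]
    constructor
    · rintro (⟨h, h'⟩ | ⟨a, ⟨h, h'⟩, rfl⟩)
      · exact ⟨h.mul_left p, mul_ne_zero hp.ne_zero h'⟩
      · exact ⟨Nat.mul_dvd_mul_left p h, mul_ne_zero hp.ne_zero h'⟩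
    · rintro ⟨h, -⟩
      by_cases hpe : p ∣ e
      · obtain ⟨a, rfl⟩ := hpe
        exact Or.inr ⟨a, ⟨Nat.dvd_of_mul_dvd_mul_left hp.pos h, hm.ne'⟩, rfl⟩
      · exact Or.inl ⟨(((Nat.Prime.coprime_iff_not_dvd hp).2 hpe).symm).dvd_of_dvd_mul_left h,
          hm.ne'⟩
  have hin : ∑ e ∈ m.divisors ∩ m.divisors.image (p * ·), χ e =
      χ p * if p ∣ m then ∑ e ∈ (m / p).divisors, χ e else 0 := by
    split_ifs with hpm
    · rw [← himg]
      refine sum_congr ?_ fun _ _ => rfl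
      obtain ⟨k, rfl⟩ := hpm
      rw [Nat.mul_div_cancel_left _ hp.pos]
      ext e
      simp only [mem_inter, mem_image, Nat.mem_divisors]
      constructor
      · rintro ⟨⟨h1, h2⟩, a, -, rfl⟩
        exact ⟨a, ⟨Nat.dvd_of_mul_dvd_mul_left hp.pos h1, right_ne_zero_of_mul h2⟩, rfl⟩
      · rintro ⟨a, ⟨h1, h2⟩, rfl⟩
        exact ⟨⟨Nat.mul_dvd_mul_left p h1, hm.ne'⟩, a, ⟨h1.mul_left p, hm.ne'⟩, rfl⟩
    · rw [mul_zero]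
      refine sum_eq_zero fun e he => absurd ?_ hpm
      simp only [mem_inter, mem_image, Nat.mem_divisors] at he
      obtain ⟨⟨h1, -⟩, a, -, rfl⟩ := he
      exact (dvd_mul_right p a).trans h1
  rw [hun, hin, himg] at h
  simp only
  linarith

theorem recursive_ncard_classes {n : ℕ} (hn : Odd n) [Fact (n ^ 2 + 4).Prime]
    (hroot : ∀ p : ℕ, p.Prime → ∀ z : ℤ, (p : ℤ) ∣ z ^ 2 + n * z - 1 →
      ∃ π : Order n, (QuadraticAlgebra.norm π).natAbs = p) :
    Recursive (fun k => legendreSym (n ^ 2 + 4) k) fun m => (classes n m).ncard := by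
  have hn0 : 0 < n := hn.pos
  refine ⟨by simp [ncard_classes_one hn0], fun p m hp hm => ?_⟩
  have : Fact p.Prime := ⟨hp⟩
  simp only
  by_cases hpd : p = n ^ 2 + 4
  · have h0 : legendreSym (n ^ 2 + 4) p = 0 := by
      rw [legendreSym.eq_zero_iff, hpd]
      exact_mod_cast ZMod.natCast_self _
    rw [h0, ncard_classes_ramified hp (π := ⟨-n, 2⟩)]
    · ring
    · have : QuadraticAlgebra.norm (⟨-n, 2⟩ : Order n) = -(p : ℤ) := by
        rw [norm_eq, hpd]; push_cast; ring
      rw [this, Int.natAbs_neg, Int.natAbs_natCast]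
    · ext <;> simp
      ring
  · by_cases hz : ∃ z : ZMod p, z ^ 2 + n * z - 1 = 0
    · rw [(chi_eq_one_iff hn hpd).2 hz]
      obtain ⟨z, hz⟩ := exists_int_of_root hz
      obtain ⟨π, hπ⟩ := hroot p hp z hz
      have h := ncard_classes_split hn0 hm hp hπ (by
        intro hc
        have hp' : Prime (p : ℤ) := Nat.prime_iff_prime_int.1 hp
        have hpN : (p : ℤ) ∣ QuadraticAlgebra.norm π := Int.natCast_dvd.2 hπ.symm.dvd
        have h1 : (p : ℤ) ∣ π.im ^ 2 * (n ^ 2 + 4 : ℕ) := by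
          have : π.im ^ 2 * ((n ^ 2 + 4 : ℕ) : ℤ) =
              (2 * π.re + n * π.im) * (2 * π.re + n * π.im) - 4 * QuadraticAlgebra.norm π := by
            rw [norm_eq]; push_cast; ring
          rw [this]
          exact dvd_sub (hc.mul_right _) (hpN.mul_left _)
        rcases hp'.dvd_or_dvd h1 with h2 | h2
        · exact not_dvd_im hp hπ (hp'.dvd_of_dvd_pow h2)
        · exact hpd ((Nat.prime_dvd_prime_iff_eq hp Fact.out).1 (Int.natCast_dvd_natCast.1 h2)))
      have h' : ((classes n (p * m)).ncard : ℤ) +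
          (if p ∣ m then ((classes n (m / p)).ncard : ℤ) else 0) = 2 * (classes n m).ncard := by
        exact_mod_cast h
      linarith
    · have h1 : legendreSym (n ^ 2 + 4) p ≠ 1 := fun h => hz ((chi_eq_one_iff hn hpd).1 h)
      have h2 : legendreSym (n ^ 2 + 4) p = -1 := by
        refine (legendreSym.eq_one_or_neg_one _ ?_).resolve_left h1
        rw [Int.cast_natCast, Ne, ZMod.natCast_eq_zero_iff]
        exact fun h => hpd ((Nat.prime_dvd_prime_iff_eq Fact.out Fact.out).1 h).symm
      push Not at hz
      rw [h2, ncard_classes_inert hp (natCast_dvd_of_inert hz)]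
      push_cast
      ring

theorem card_cone {n : ℕ} (hn : Odd n) [Fact (n ^ 2 + 4).Prime]
    (hroot : ∀ p : ℕ, p.Prime → ∀ z : ℤ, (p : ℤ) ∣ z ^ 2 + n * z - 1 →
      ∃ π : Order n, (QuadraticAlgebra.norm π).natAbs = p) {m : ℕ} (hm : 0 < m) :
    (#(cone n m) : ℤ) = ∑ e ∈ m.divisors, legendreSym (n ^ 2 + 4) e := by
  rw [← ncard_classes hn.pos hm]
  exact (recursive_ncard_classes hn hroot).unique
    (recursive_sum_divisors (by simp) (by intro a b; push_cast; exact legendreSym.mul _ _ _)) m hm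

/-! ### Rearranging the sums -/

theorem tsum_fiber {φ : ℕ × ℕ → ℕ} {F : ℕ × ℕ → ℝ} {m : ℕ} (s : Finset (ℕ × ℕ))
    (h : ∀ z, φ z = m → F z ≠ 0 → z ∈ s) (h' : ∀ z ∈ s, φ z = m) :
    ∑' z : φ ⁻¹' {m}, F z = ∑ z ∈ s, F z := by
  rw [tsum_subtype (φ ⁻¹' {m}) F, tsum_eq_sum (s := s)]
  · exact sum_congr rfl fun z hz => Set.indicator_of_mem (s := φ ⁻¹' {m}) (h' z hz) F
  · intro z hz
    rw [Set.indicator_apply_eq_zero]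
    intro hm
    by_contra h0
    exact hz (h z hm h0)

/-- The value of the norm form in the cone. -/
theorem natAbs_norm_of_lt {n X Y : ℕ} (h : Y < n * X) :
    X ^ 2 + n * X * Y = ((X : ℤ) ^ 2 + n * X * Y - (Y : ℤ) ^ 2).natAbs + Y ^ 2 := by
  zify
  rw [abs_of_nonneg]
  · ring
  · have : (Y : ℤ) < n * X := by exact_mod_cast h
    nlinarith [(Nat.cast_nonneg Y : (0 : ℤ) ≤ Y), sq_nonneg (X : ℤ)]

theorem hasSum_cone {n : ℕ} {f : ℤ → ℝ} {K t : ℝ} (hf : ∀ x, |f x| ≤ K) (ht : 0 < t) :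
    HasSum (fun m : ℕ => #(cone n m) * (f m * Real.exp (-(t * m))))
      (∑' X : ℕ, ∑ Y ∈ range (n * X), f ((X : ℤ) ^ 2 + n * X * Y - (Y : ℤ) ^ 2) *
        Real.exp (-(t * ((X : ℝ) ^ 2 + n * X * Y - (Y : ℝ) ^ 2)))) := by
  set F : ℕ × ℕ → ℝ := fun z => if z.2 < n * z.1 then
    f ((z.1 : ℤ) ^ 2 + n * z.1 * z.2 - (z.2 : ℤ) ^ 2) *
      Real.exp (-(t * ((z.1 : ℝ) ^ 2 + n * z.1 * z.2 - (z.2 : ℝ) ^ 2))) else 0 with hF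
  have hK : 0 ≤ K := (abs_nonneg _).trans (hf 0)
  have hinner (X : ℕ) : HasSum (fun Y => ‖F (X, Y)‖) (∑ Y ∈ range (n * X), ‖F (X, Y)‖) := by
    refine hasSum_sum_of_ne_finset_zero fun Y hY => ?_
    simp only [mem_range] at hY
    simp [hF, hY]
  have hbound (X Y : ℕ) : ‖F (X, Y)‖ ≤ K * Real.exp (-t * X) := by
    simp only [hF]
    split_ifs with h
    · rw [norm_mul, Real.norm_eq_abs, Real.norm_eq_abs, Real.abs_exp]
      refine mul_le_mul (hf _) (Real.exp_le_exp.2 ?_) (Real.exp_pos _).le hK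
      have h1 : (Y : ℝ) < n * X := by exact_mod_cast h
      have h2 : (X : ℝ) ≤ X ^ 2 := by exact_mod_cast Nat.le_self_pow two_ne_zero X
      nlinarith [mul_nonneg (Nat.cast_nonneg Y : (0 : ℝ) ≤ Y) (sub_nonneg.2 h1.le)]
    · rw [norm_zero]
      positivity
  have hsum : Summable F := by
    refine Summable.of_norm ((summable_prod_of_nonneg fun z => norm_nonneg _).2
      ⟨fun X => (hinner X).summable, ?_⟩)
    refine Summable.of_nonneg_of_le (fun X => tsum_nonneg fun Y => norm_nonneg _) (fun X => ?_)
      ((Real.summable_pow_mul_exp_neg_nat_mul 1 ht).mul_left (n * K))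
    rw [(hinner X).tsum_eq]
    refine (sum_le_sum fun Y _ => hbound X Y).trans (le_of_eq ?_)
    simp only [sum_const, card_range, nsmul_eq_mul]
    push_cast
    ring
  have h1 := hsum.hasSum.tsum_fiberwise
    fun z => ((z.1 : ℤ) ^ 2 + n * z.1 * z.2 - (z.2 : ℤ) ^ 2).natAbs
  have h2 : ∑' z, F z = ∑' X : ℕ, ∑ Y ∈ range (n * X),
      f ((X : ℤ) ^ 2 + n * X * Y - (Y : ℤ) ^ 2) *
        Real.exp (-(t * ((X : ℝ) ^ 2 + n * X * Y - (Y : ℝ) ^ 2))) := by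
    rw [hsum.tsum_prod]
    refine tsum_congr fun X => ?_
    rw [tsum_eq_sum (s := range (n * X))]
    · refine sum_congr rfl fun Y hY => ?_
      rw [mem_range] at hY
      simp [hF, hY]
    · intro Y hY
      simp only [mem_range] at hY
      simp [hF, hY]
  rw [h2] at h1
  refine h1.congr_fun fun m => ?_
  rw [tsum_fiber (cone n m)]
  · rw [← nsmul_eq_mul, ← sum_const]
    refine sum_congr rfl fun z hz => ?_
    obtain ⟨h3, h4⟩ := mem_cone.1 hz
    simp only [hF, h3, if_true]
    have h5 : (z.1 : ℤ) ^ 2 + n * z.1 * z.2 - (z.2 : ℤ) ^ 2 = m := by zify at h4; linarith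
    have h6 : (z.1 : ℝ) ^ 2 + n * z.1 * z.2 - (z.2 : ℝ) ^ 2 = m := by exact_mod_cast h5
    rw [h5, h6]
  · rintro ⟨X, Y⟩ hm h0
    have h3 : Y < n * X := by
      by_contra h3
      simp [hF, h3] at h0
    rw [mem_cone]
    exact ⟨h3, by rw [natAbs_norm_of_lt h3, hm]⟩
  · rintro ⟨X, Y⟩ hz
    obtain ⟨h3, h4⟩ := mem_cone.1 hz
    have := natAbs_norm_of_lt h3
    simp only
    omega

theorem hasSum_hyperbola {f χ : ℤ → ℝ} {K t : ℝ} (hf : ∀ x, |f x| ≤ K) (hχ : ∀ x, |χ x| ≤ 1)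
    (hf0 : f 0 = 0) (ht : 0 < t) :
    HasSum (fun m : ℕ => (∑ e ∈ m.divisors, χ e) * (f m * Real.exp (-(t * m))))
      (∑' k : ℕ, ∑' l : ℕ, f ((k : ℤ) * l) * χ l * Real.exp (-(t * (k * l)))) := by
  set F : ℕ × ℕ → ℝ := fun z =>
    f ((z.1 : ℤ) * z.2) * χ z.2 * Real.exp (-(t * (z.1 * z.2))) with hF
  have hK : 0 ≤ K := (abs_nonneg _).trans (hf 0)
  have hg : Summable fun k : ℕ => Real.exp (-(t / 2) * k) := by
    simpa using Real.summable_pow_mul_exp_neg_nat_mul 0 (half_pos ht)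
  have hsum : Summable F := by
    refine Summable.of_norm_bounded ((hg.mul_of_nonneg hg (fun _ => (Real.exp_pos _).le)
      fun _ => (Real.exp_pos _).le).mul_left K) ?_
    rintro ⟨k, l⟩
    simp only [hF]
    by_cases h0 : k = 0 ∨ l = 0
    · have : (k : ℤ) * l = 0 := by rcases h0 with rfl | rfl <;> simp
      rw [this, hf0]
      simp only [zero_mul, norm_zero]
      positivity
    · push Not at h0
      rw [norm_mul, norm_mul, Real.norm_eq_abs, Real.norm_eq_abs, Real.norm_eq_abs, Real.abs_exp,
        ← Real.exp_add]
      refine mul_le_mul ?_ (Real.exp_le_exp.2 ?_) (Real.exp_pos _).le hK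
      · calc _ ≤ K * 1 := mul_le_mul (hf _) (hχ _) (abs_nonneg _) hK
          _ = K := mul_one K
      · have h1 : (1 : ℝ) ≤ k := by exact_mod_cast Nat.one_le_iff_ne_zero.2 h0.1
        have h2 : (1 : ℝ) ≤ l := by exact_mod_cast Nat.one_le_iff_ne_zero.2 h0.2
        nlinarith [mul_nonneg (sub_nonneg.2 h1) (sub_nonneg.2 h2), mul_nonneg ht.le
          (mul_nonneg (sub_nonneg.2 h1) (sub_nonneg.2 h2))]
  have h1 := hsum.hasSum.tsum_fiberwise fun z => z.1 * z.2
  have h2 : ∑' z, F z = ∑' k : ℕ, ∑' l : ℕ, f ((k : ℤ) * l) * χ l * Real.exp (-(t * (k * l))) := by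
    rw [hsum.tsum_prod]
  rw [h2] at h1
  refine h1.congr_fun fun m => ?_
  rw [tsum_fiber m.divisorsAntidiagonal]
  · rw [← Nat.map_div_left_divisors, sum_map, sum_mul]
    refine sum_congr rfl fun e he => ?_
    have h3 : m / e * e = m := Nat.div_mul_cancel (Nat.dvd_of_mem_divisors he)
    have h4 : ((m / e : ℕ) : ℤ) * e = m := by exact_mod_cast h3
    have h5 : ((m / e : ℕ) : ℝ) * e = m := by exact_mod_cast h3
    change _ = f (((m / e : ℕ) : ℤ) * e) * χ e * Real.exp (-(t * (((m / e : ℕ) : ℝ) * e)))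
    rw [h4, h5]
    ring
  · rintro ⟨k, l⟩ hm h0
    rw [Nat.mem_divisorsAntidiagonal]
    refine ⟨hm, ?_⟩
    rintro rfl
    have : (k : ℤ) * l = 0 := by exact_mod_cast hm
    simp [hF, this, hf0] at h0
  · exact fun z hz => (Nat.mem_divisorsAntidiagonal.1 hz).1

/-! ### The resulting identity between finite sums -/

theorem Weight.edge_edge {n q : ℕ} {w : ℤ → ℤ → ℝ} (hw : Weight n q w) :
    edge q (fun X => edge q (w X) 0) 0 =
      ∑ X ∈ range q, ∑ Y ∈ range q, w X Y * (β₁ q X * β₁ q Y) := by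
  have h00 : w 0 0 = 0 := by
    have := hw.rot 0 0
    rw [neg_zero] at this
    linarith
  have hX0 (X : ℤ) : w X 0 = -w 0 X := by
    have := hw.rot 0 X
    rwa [neg_zero] at this
  have h0 := hw.edge_zero
  have h1 : ∑ X ∈ range q, w X 0 / 2 * β₁ q X = 0 := by
    rw [edge, shiftSum, h00] at h0
    simp only [zero_add, zero_div, add_zero] at h0
    have : ∀ X ∈ range q, w X 0 / 2 * β₁ q X = -(1 / 2) * (w 0 X * β₁ q X) := fun X _ => by
      rw [hX0]; ring
    rw [sum_congr rfl this, ← mul_sum, h0, mul_zero]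
  rw [edge, h0, zero_div, add_zero, shiftSum]
  simp only [edge, shiftSum, zero_add, add_mul, sum_add_distrib, h1, add_zero, sum_mul]
  refine sum_congr rfl fun X _ => sum_congr rfl fun Y _ => by ring

theorem Weight.limit_eq {n q : ℕ} {w : ℤ → ℤ → ℝ} (hw : Weight n q w) :
    2 * edge q (fun X => edge q (w X) 0) 0
        + n * mean q (fun X => shiftSum q (β₂ q) (w X) 0)
        - n * shiftSum q (β₂ q) (fun X => mean q (w X)) 0 =
      (∑ X ∈ range q, ∑ Y ∈ range q, w X Y * ((2 * X - q) * (2 * Y - q))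
        + 2 * n * ∑ X ∈ range q, ∑ Y ∈ range q, w X Y * (X * (q - X))) / (2 * q ^ 2) := by
  have hq : (q : ℝ) ≠ 0 := by exact_mod_cast hw.pos.ne'
  have h1 : edge q (fun X => edge q (w X) 0) 0 =
      (∑ X ∈ range q, ∑ Y ∈ range q, w X Y * ((2 * X - q) * (2 * Y - q))) / (4 * q ^ 2) := by
    rw [hw.edge_edge, sum_div]
    refine sum_congr rfl fun X _ => ?_
    rw [sum_div]
    refine sum_congr rfl fun Y _ => ?_
    simp only [β₁]
    field_simp
    ring
  have h2 : mean q (fun X => shiftSum q (β₂ q) (w X) 0) =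
      -(∑ X ∈ range q, ∑ Y ∈ range q, w X Y * β₂ q X) / q := by
    rw [← hw.sum_rot]
    simp only [mean, shiftSum, zero_add]
  have h3 : shiftSum q (β₂ q) (fun X => mean q (w X)) 0 =
      (∑ X ∈ range q, ∑ Y ∈ range q, w X Y * β₂ q X) / q := by
    simp only [mean, shiftSum, zero_add, sum_div, sum_mul]
    refine sum_congr rfl fun X _ => sum_congr rfl fun Y _ => by ring
  have h4 : ∑ X ∈ range q, ∑ Y ∈ range q, w X Y * β₂ q X =
      -(∑ X ∈ range q, ∑ Y ∈ range q, w X Y * (X * (q - X))) / (2 * q) := by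
    have h5 : ∀ X ∈ range q, ∀ Y ∈ range q, w X Y * β₂ q X =
        -(1 / (2 * q)) * (w X Y * (X * (q - X))) + q / 12 * w X Y := fun X _ Y _ => by
      simp only [β₂]
      field_simp
      ring
    rw [sum_congr rfl fun X hX => sum_congr rfl (h5 X hX)]
    simp only [sum_add_distrib, ← mul_sum, hw.sum_eq_zero]
    ring
  rw [h1, h2, h3, h4]
  field_simp
  ring

theorem weight_of_odd {n q : ℕ} (hq : 0 < q) {f : ℤ → ℝ} (per : Function.Periodic f q)
    (odd : ∀ x, f (-x) = -f x) : Weight n q fun X Y => f (X ^ 2 + n * X * Y - Y ^ 2) where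
  pos := hq
  perX X Y := by
    rw [← per.int_mul (2 * X + q + n * Y) (X ^ 2 + n * X * Y - Y ^ 2)]
    congr 1
    push_cast
    ring
  perY X Y := by
    rw [← per.int_mul (n * X - 2 * Y - q) (X ^ 2 + n * X * Y - Y ^ 2)]
    congr 1
    push_cast
    ring
  neg X Y := by congr 1; ring
  rot X Y := by rw [← odd]; congr 1; ring
  refl X Y := by congr 1; ring

theorem cone_identity {n q : ℕ} (hn : Odd n) [Fact (n ^ 2 + 4).Prime]
    (hroot : ∀ p : ℕ, p.Prime → ∀ z : ℤ, (p : ℤ) ∣ z ^ 2 + n * z - 1 →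
      ∃ π : Order n, (QuadraticAlgebra.norm π).natAbs = p)
    (hq : 0 < q) {f : ℤ → ℤ} (per : Function.Periodic f q) (odd : ∀ x, f (-x) = -f x) :
    ((n ^ 2 + 4 : ℕ) : ℤ) *
      (∑ X ∈ range q, ∑ Y ∈ range q,
          f ((X : ℤ) ^ 2 + n * X * Y - (Y : ℤ) ^ 2) * ((2 * X - q) * (2 * Y - q))
        + 2 * n * ∑ X ∈ range q, ∑ Y ∈ range q,
          f ((X : ℤ) ^ 2 + n * X * Y - (Y : ℤ) ^ 2) * (X * (q - X))) =
      2 * ∑ a ∈ range q, ∑ b ∈ range (q * (n ^ 2 + 4)),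
        f (a * b) * legendreSym (n ^ 2 + 4) b * (a * b) := by
  set d := n ^ 2 + 4 with hd
  have hd0 : 0 < d := by omega
  set g : ℤ → ℝ := fun x => (f x : ℝ) with hg
  set χ : ℤ → ℝ := fun x => (legendreSym d x : ℝ) with hχ
  have gper : Function.Periodic g q := fun x => by simp only [hg, per x]
  have godd (x : ℤ) : g (-x) = -g x := by simp [hg, odd]
  have g0 : g 0 = 0 := by have := godd 0; rw [neg_zero] at this; linarith
  have χper (x : ℤ) : χ (x + d) = χ x := by
    simp only [hχ]
    rw [legendreSym.mod, Int.add_emod_right, ← legendreSym.mod]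
  have χneg (x : ℤ) : χ (-x) = χ x := by
    simp only [hχ]
    rw [← neg_one_mul, legendreSym.mul, legendreSym.at_neg_one (by omega),
      ZMod.χ₄_nat_one_mod_four (mod_four_eq_one hn), one_mul]
  have χle (x : ℤ) : |χ x| ≤ 1 := by
    simp only [hχ]
    by_cases h : ((x : ℤ) : ZMod d) = 0
    · rw [(legendreSym.eq_zero_iff d x).2 h]; simp
    · rcases legendreSym.eq_one_or_neg_one d h with h | h <;> simp [h]
  obtain ⟨K, -, hK⟩ := exists_periodic_bound hq gper
  have hw := weight_of_odd (n := n) hq gper godd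
  have hT := tendsto_hyperbola (q := q) (N := q * d)
      (v := fun a b => g (a * b) * χ b) hq (by positivity)
    (fun a b => by
      rw [← gper.int_mul b (a * b)]
      congr 2
      push_cast
      ring)
    (fun a b => by
      congr 1
      · rw [← gper.int_mul (a * d) (a * b)]
        congr 1
        push_cast
        ring
      · have : Function.Periodic χ d := χper
        rw [← this.int_mul q b]
        congr 1)
    (fun a b => by rw [neg_mul, godd, neg_mul])
    (fun a b => by rw [mul_neg, godd, χneg, neg_mul])
  have hsq : Tendsto (fun u : ℝ => u ^ 2) (𝓝[>] 0) (𝓝[>] 0) := by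
    refine tendsto_nhdsWithin_iff.2 ⟨?_, ?_⟩
    · have : Tendsto (fun u : ℝ => u ^ 2) (𝓝 0) (𝓝 (0 ^ 2)) := (continuous_pow 2).tendsto 0
      rw [zero_pow two_ne_zero] at this
      exact this.mono_left nhdsWithin_le_nhds
    · filter_upwards [self_mem_nhdsWithin] with u hu
      exact pow_pos (Set.mem_Ioi.1 hu) 2
  have hS := hw.tendsto_cone
  have heq : ∀ᶠ u : ℝ in 𝓝[>] 0,
      ∑' X : ℕ, coneSlice n (fun X Y => g (X ^ 2 + n * X * Y - Y ^ 2)) u X =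
      ∑' k : ℕ, ∑' l : ℕ, g (k * l) * χ l * Real.exp (-(u ^ 2 * (k * l))) := by
    filter_upwards [self_mem_nhdsWithin] with u hu
    have hu2 : 0 < u ^ 2 := pow_pos (Set.mem_Ioi.1 hu) 2
    have h1 := hasSum_cone (n := n) hK hu2
    have h2 := hasSum_hyperbola hK χle g0 hu2
    have h3 : (fun m : ℕ => #(cone n m) * (g m * Real.exp (-(u ^ 2 * m)))) =
        fun m : ℕ => (∑ e ∈ m.divisors, χ e) * (g m * Real.exp (-(u ^ 2 * m))) := by
      funext m
      rcases Nat.eq_zero_or_pos m with rfl | hm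
      · simp [g0]
      · have := card_cone hn hroot hm
        have h4 : (#(cone n m) : ℝ) = ∑ e ∈ m.divisors, χ e := by
          simp only [hχ]
          exact_mod_cast this
        rw [h4]
    rw [h3] at h1
    rw [← h1.unique h2]
    refine tsum_congr fun X => ?_
    simp only [coneSlice, neg_mul]
  have hlim := tendsto_nhds_unique (hS.congr' heq) (hT.comp hsq)
  rw [hw.limit_eq] at hlim
  have hq' : (q : ℝ) ≠ 0 := by exact_mod_cast hq.ne'
  have hd' : (d : ℝ) ≠ 0 := by exact_mod_cast hd0.ne'
  have hfin : (d : ℝ) *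
      (∑ X ∈ range q, ∑ Y ∈ range q,
          g ((X : ℤ) ^ 2 + n * X * Y - (Y : ℤ) ^ 2) * ((2 * X - q) * (2 * Y - q))
        + 2 * n * ∑ X ∈ range q, ∑ Y ∈ range q,
          g ((X : ℤ) ^ 2 + n * X * Y - (Y : ℤ) ^ 2) * (X * (q - X))) =
      2 * ∑ a ∈ range q, ∑ b ∈ range (q * d), g (a * b) * χ b * (a * b) := by
    simp only [← sum_div] at hlim
    push_cast at hlim
    field_simp at hlim
    simp only [← mul_assoc]
    linarith
  simp only [hg, hχ] at hfin
  exact_mod_cast hfin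

/-! ### Reducing the identity modulo a prime -/

/-- The sum `∑ i < k, g i`, in a form the kernel evaluates quickly. -/
def sumTo (g : ℕ → ℕ) (k : ℕ) : ℕ := Nat.rec (nat_lit 0) (fun i s => Nat.add s (g i)) k

/-- The `x`-th digit of `T` in base `128`. -/
def digit (T x : ℕ) : ℕ := Nat.mod (Nat.shiftRight T (Nat.mul (nat_lit 7) x)) (nat_lit 128)

/-- With `u = 2C + k`, `v = C (q - C)` and `k ≡ -q` modulo `ℓ`, this packs the two sums of
`cone_identity` modulo `ℓ` into one number, the second one being multiplied by `M`. -/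
def packed (T q k M r : ℕ) : ℕ :=
  sumTo (fun C => sumTo (fun D => Nat.mul
    (digit T (Nat.mod (Nat.add (Nat.mul C (Nat.add C (Nat.mul r D)))
      (Nat.mul (Nat.pred q) (Nat.mul D D))) q))
    (Nat.add (Nat.mul (Nat.add (Nat.add C C) k) (Nat.add (Nat.add D D) k))
      (Nat.mul M (Nat.mul C (Nat.sub q C))))) q) q

theorem sumTo_eq (g : ℕ → ℕ) (k : ℕ) : sumTo g k = ∑ i ∈ range k, g i := by
  induction k with
  | zero => rfl
  | succ k ih => rw [sum_range_succ, ← ih]; rfl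

theorem digit_lt (T x : ℕ) : digit T x < 128 := Nat.mod_lt _ (by norm_num)

theorem packed_eq (T q k M r : ℕ) : packed T q k M r =
    ∑ C ∈ range q, ∑ D ∈ range q,
      digit T ((C * (C + r * D) + (q - 1) * (D * D)) % q) * ((C + C + k) * (D + D + k)) +
    M * ∑ C ∈ range q, ∑ D ∈ range q,
      digit T ((C * (C + r * D) + (q - 1) * (D * D)) % q) * (C * (q - C)) := by
  simp only [mul_sum, ← sum_add_distrib]
  unfold packed
  simp only [sumTo_eq]
  refine sum_congr rfl fun C _ => sum_congr rfl fun D _ => ?_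
  change digit T ((C * (C + r * D) + (q - 1) * (D * D)) % q) *
    ((C + C + k) * (D + D + k) + M * (C * (q - C))) = _
  ring

/-- The digits of `T` are the values modulo `ℓ` of an odd function `χ` modulo `q` such that
`∑ a, χ(ab) a` vanishes modulo `ℓ` for all `b`. -/
def IsTable (T q l : ℕ) : Prop :=
  (∀ i < q, l ∣ digit T i + digit T ((q - i) % q)) ∧
    ∀ b < q, l ∣ sumTo (fun a => Nat.mul (digit T (Nat.mod (Nat.mul a b) q)) a) q

instance (T q l : ℕ) : Decidable (IsTable T q l) := by unfold IsTable; infer_instance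

/-- The integer-valued odd function with table `T`. -/
def tableFun (T q l : ℕ) (x : ℤ) : ℤ := ((digit T (x % q).toNat : ℕ) : ZMod l).valMinAbs

section Table

variable {T q l : ℕ}

theorem coe_tableFun (x : ℤ) : (tableFun T q l x : ZMod l) = (digit T (x % q).toNat : ℕ) :=
  ZMod.coe_valMinAbs _

theorem tableFun_periodic : Function.Periodic (tableFun T q l) q := fun x => by
  simp [tableFun]

theorem tableFun_neg (hT : IsTable T q l) (hl : Odd l) (hq : 0 < q) (x : ℤ) :
    tableFun T q l (-x) = -tableFun T q l x := by
  unfold tableFun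
  rw [← ZMod.valMinAbs_neg_of_ne_half]
  · congr 1
    rw [eq_neg_iff_add_eq_zero, ← Nat.cast_add, ZMod.natCast_eq_zero_iff]
    have hq' : (0 : ℤ) < q := by exact_mod_cast hq
    obtain ⟨i, hi⟩ := Int.eq_ofNat_of_zero_le (Int.emod_nonneg x hq'.ne')
    have hiq : i < q := by have := Int.emod_lt_of_pos x hq'; omega
    have hneg : (-x) % q = ((q - i) % q : ℕ) := by
      push_cast [hiq.le]
      rw [← hi]
      change _ ≡ _ [ZMOD q]
      rw [Int.modEq_iff_dvd]
      refine ⟨1 + x / q, ?_⟩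
      linarith [Int.emod_add_mul_ediv x q]
    rw [hneg, hi, Int.toNat_natCast, Int.toNat_natCast, add_comm]
    exact hT.1 i hiq
  · intro h
    obtain ⟨t, ht⟩ := hl
    omega

theorem packed_relation {n M r : ℕ} (hn : Odd n) [Fact (n ^ 2 + 4).Prime] [Fact l.Prime]
    (hroot : ∀ p : ℕ, p.Prime → ∀ z : ℤ, (p : ℤ) ∣ z ^ 2 + n * z - 1 →
      ∃ π : Order n, (QuadraticAlgebra.norm π).natAbs = p)
    (hT : IsTable T q l) (hl : Odd l) (hq : 0 < q) (hr : n % q = r)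
    (hd : ¬ l ∣ n ^ 2 + 4) (hM : 128 * (q * (q * ((l + 1) * q) ^ 2)) < M) :
    l ∣ packed T q ((l - 1) * q) M r % M + 2 * (n % l) * (packed T q ((l - 1) * q) M r / M) := by
  have hl1 : 1 ≤ l := (Fact.out : l.Prime).one_le
  have key := congrArg (Int.cast : ℤ → ZMod l)
    (cone_identity hn hroot hq tableFun_periodic (tableFun_neg hT hl hq))
  have hdig (C D : ℕ) : digit T ((C * (C + r * D) + (q - 1) * (D * D)) % q) =
      digit T (((C : ℤ) ^ 2 + n * C * D - (D : ℤ) ^ 2) % q).toNat := by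
    congr 1
    have : (((C : ℤ) ^ 2 + n * C * D - (D : ℤ) ^ 2) % q) =
        (((C * (C + r * D) + (q - 1) * (D * D)) % q : ℕ) : ℤ) := by
      rw [Int.natCast_mod]
      change _ ≡ _ [ZMOD q]
      have h : (n : ℤ) = r + q * (n / q : ℕ) := by
        rw [← hr]; exact_mod_cast (Nat.mod_add_div n q).symm
      generalize n / q = t at h
      refine (Int.modEq_iff_dvd).2 ?_
      rw [h]
      push_cast [hq]
      refine ⟨D ^ 2 - C * D * t, ?_⟩
      ring
    rw [this]; rfl
  have hs (C : ℕ) : ((C + C + (l - 1) * q : ℕ) : ZMod l) = 2 * C - q := by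
    push_cast [hl1]
    rw [ZMod.natCast_self]
    ring
  have hbound : ∑ C ∈ range q, ∑ D ∈ range q,
      digit T ((C * (C + r * D) + (q - 1) * (D * D)) % q) *
        ((C + C + (l - 1) * q) * (D + D + (l - 1) * q)) < M := by
    refine lt_of_le_of_lt ?_ hM
    have h1 {C : ℕ} (hC : C ∈ range q) : C + C + (l - 1) * q ≤ (l + 1) * q := by
      obtain ⟨m, rfl⟩ := Nat.exists_eq_add_of_le hl1
      rw [mem_range] at hC
      simp only [Nat.add_sub_cancel_left]
      nlinarith
    calc _ ≤ ∑ C ∈ range q, ∑ D ∈ range q, 128 * (((l + 1) * q) * ((l + 1) * q)) := by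
          gcongr with C hC D hD
          · exact (digit_lt _ _).le
          · exact h1 hC
          · exact h1 hD
      _ = _ := by simp; ring
  have hM0 : 0 < M := by omega
  rw [packed_eq, Nat.add_mul_mod_self_left, Nat.mod_eq_of_lt hbound, Nat.add_mul_div_left _ _ hM0,
    Nat.div_eq_of_lt hbound, zero_add, ← ZMod.natCast_eq_zero_iff]
  have hrhs : ((2 * ∑ a ∈ range q, ∑ b ∈ range (q * (n ^ 2 + 4)),
      tableFun T q l (a * b) * legendreSym (n ^ 2 + 4) b * (a * b) : ℤ) : ZMod l) = 0 := by
    rw [sum_comm, Int.cast_mul, Int.cast_sum, sum_eq_zero, mul_zero]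
    intro b _
    have hb : ((∑ a ∈ range q, digit T (a * (b % q) % q) * a : ℕ) : ZMod l) = 0 := by
      rw [ZMod.natCast_eq_zero_iff]
      have := hT.2 (b % q) (Nat.mod_lt _ hq)
      rwa [sumTo_eq] at this
    have : ∀ a : ℕ, (tableFun T q l (a * b) : ZMod l) = (digit T (a * (b % q) % q) : ℕ) := by
      intro a
      rw [coe_tableFun, ← Nat.cast_mul, ← Int.natCast_mod, Int.toNat_natCast, Nat.mul_mod,
        Nat.mul_mod a (b % q), Nat.mod_mod]
    push_cast at hb ⊢
    simp only [this]
    calc _ = (legendreSym (n ^ 2 + 4) b : ZMod l) * b *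
          ∑ a ∈ range q, (digit T (a * (b % q) % q) : ZMod l) * a := by
          rw [mul_sum]
          exact sum_congr rfl fun a _ => by ring
      _ = 0 := by rw [hb, mul_zero]
  rw [hrhs, Int.cast_mul, mul_eq_zero] at key
  have hd' : (((n ^ 2 + 4 : ℕ) : ℤ) : ZMod l) ≠ 0 := by
    rwa [Int.cast_natCast, Ne, ZMod.natCast_eq_zero_iff]
  have key := key.resolve_left hd'
  rw [← key]
  simp only [Nat.cast_add, Nat.cast_mul, Nat.cast_sum, Int.cast_add, Int.cast_mul, Int.cast_sum,
    coe_tableFun, ← hdig]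
  congr 1
  · refine sum_congr rfl fun C _ => sum_congr rfl fun D _ => ?_
    have h := congrArg₂ (· * ·) (hs C) (hs D)
    push_cast at h ⊢
    rw [h]
  · congr 1
    · simp
    · refine sum_congr rfl fun C hC => sum_congr rfl fun D _ => ?_
      rw [Nat.cast_sub (mem_range.1 hC).le]
      push_cast
      ring

end Table

/-! ### Tables of odd functions -/

/-- The polynomial `z² + rz - 1` has no root modulo `p`. -/
def NoRoot (p r : ℕ) : Prop := ∀ z < p, ¬ p ∣ z * z + r * z + (p - 1)

instance (p r : ℕ) : Decidable (NoRoot p r) := by unfold NoRoot; infer_instance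

theorem noRoot_mod {p n r : ℕ} (hp : 0 < p) (h : ∀ z : ℤ, ¬ (p : ℤ) ∣ z ^ 2 + n * z - 1)
    (hr : n ≡ r [MOD p]) : NoRoot p r := by
  intro z _ hz
  apply h z
  rw [← Int.natCast_dvd_natCast, ← Int.modEq_zero_iff_dvd] at hz
  rw [← Int.modEq_zero_iff_dvd]
  refine Int.ModEq.trans ?_ hz
  push_cast [Nat.one_le_iff_ne_zero.2 hp.ne']
  calc (z : ℤ) ^ 2 + n * z - 1 ≡ z ^ 2 + r * z - 1 [ZMOD p] := by
        gcongr
        exact (Int.natCast_modEq_iff.2 hr)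
    _ ≡ z * z + r * z + (p - 1) [ZMOD p] := by
        rw [Int.modEq_iff_dvd]
        exact ⟨1, by ring⟩

/-- The values of an odd function modulo `85` with values in `ZMod 73`. -/
def table85 : ℕ :=
  nat_lit 73514482840753840670018523161232516696805613392481006036983480902367644110226354674966968558202867330898992559329561465761757073147259827613709059637952162492810382097241568460928

theorem isTable85 : IsTable table85 85 73 := by decide +kernel

/-- The residues `r` modulo `85` to be considered, with the packed sums attached to them. -/
def sums85 : List (ℕ × ℕ) :=
  [(12, 302035600009711153555600),
   (13, 305558000009711143814600),
   (18, 302035600009711138044800),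
   (22, 302035600009711133407200),
   (23, 305928600009711139054600),
   (28, 305928600009711137735400),
   (33, 302035600009711141404000),
   (38, 305558000009711143148200),
   (47, 305558000009711126359000),
   (52, 302035600009711128103200),
   (57, 305928600009711131771800),
   (62, 305928600009711130452600),
   (63, 302035600009711136100000),
   (67, 302035600009711131462400),
   (72, 305558000009711125692600),
   (73, 302035600009711115951600)]

theorem packed_sums85 :
    ∀ p ∈ sums85, Nat.beq (packed table85 85 6120 (10 ^ 15) p.1) p.2 = true := by
  decide +kernel

/-- The values of an odd function modulo `73` with values in `ZMod 89`. -/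
def table73 : ℕ :=
  nat_lit 4645052167311268661255417393290321969468989450697075370634642622953258679799960808582740419801190006100856161854215591648177704425727952081085073484431488

theorem isTable73 : IsTable table73 73 89 := by decide +kernel

/-- The residues `r` modulo `73` to be considered, with the packed sums attached to them. -/
def sums73 : List (ℕ × ℕ) :=
  [(3, 211646272010005010112796),
   (15, 212581840010005028074008),
   (25, 208579688010005031018536),
   (28, 211646272010005020231180),
   (30, 212581840010005018518016),
   (43, 212581840010005025876416),
   (45, 211646272010005024163252),
   (48, 208579688010005013375896),
   (58, 212581840010005016320424),
   (70, 211646272010005034281636)]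

theorem packed_sums73 :
    ∀ p ∈ sums73, Nat.beq (packed table73 73 6424 (10 ^ 15) p.1) p.2 = true := by
  decide +kernel

/-- The values of an odd function modulo `219` with values in `ZMod 37`. -/
def table219 : ℕ :=
  nat_lit 85362811422329159563878117106262989703715503848106318229965462235381086226148956600237287559496204423153823834567273139743875555643757354938591958443522263949301226650211994852459489334961467748517528851212779707248110195913611470032543996583463140225703145021010753726638777558836607642880806000189287470339164430821789514579752985747449688116324432030784198937344864907054888755243102177164559767738858191519666991397582530416393430453129506601568318036951168

theorem isTable219 : IsTable table219 219 37 := by decide +kernel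

/-- The residues `r` modulo `219` to be considered, with the packed sums attached to them. -/
def sums219 : List (ℕ × ℕ) :=
  [(70, 6307197664051765238634584),
   (76, 6307197664051765257230312),
   (143, 6307197664051765237440888),
   (149, 6307197664051765256036616)]

theorem packed_sums219 :
    ∀ p ∈ sums219, Nat.beq (packed table219 219 7884 (10 ^ 15) p.1) p.2 = true := by
  decide +kernel


theorem false_of_noRoot {n : ℕ} (hn : Odd n) [Fact (n ^ 2 + 4).Prime] (hn89 : 89 < n)
    (hroot : ∀ p : ℕ, p.Prime → ∀ z : ℤ, (p : ℤ) ∣ z ^ 2 + n * z - 1 →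
      ∃ π : Order n, (QuadraticAlgebra.norm π).natAbs = p)
    (hinert : ∀ p : ℕ, p.Prime → p < n → ∀ z : ℤ, ¬ (p : ℤ) ∣ z ^ 2 + n * z - 1) : False := by
  have inert {p r : ℕ} (hp : p.Prime) (hpn : p < n) (hr : n ≡ r [MOD p]) : NoRoot p r :=
    noRoot_mod hp.pos (hinert p hp hpn) hr
  have rel {T q l : ℕ} (hq : 0 < q) (hl : l.Prime) (hln : l < n) (hl2 : Odd l)
      (hT : IsTable T q l) (hM : 128 * (q * (q * ((l + 1) * q) ^ 2)) < 10 ^ 15) {p : ℕ × ℕ}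
      (hp : Nat.beq (packed T q ((l - 1) * q) (10 ^ 15) p.1) p.2 = true) (hr : n % q = p.1) :
      l ∣ p.2 % 10 ^ 15 + 2 * (n % l) * (p.2 / 10 ^ 15) := by
    have : Fact l.Prime := ⟨hl⟩
    rw [← Nat.eq_of_beq_eq_true hp]
    refine packed_relation hn hroot hT hl2 hq hr (fun h => ?_) hM
    rcases (Nat.dvd_prime (Fact.out : (n ^ 2 + 4).Prime)).1 h with h | h
    · exact hl.one_lt.ne' h
    · nlinarith
  have h85 : n % 85 ∈ sums85.map Prod.fst := by
    have key : ∀ r < 85, NoRoot 5 r → NoRoot 17 r → r ∈ sums85.map Prod.fst := by decide +kernel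
    refine key _ (Nat.mod_lt _ (by norm_num)) (inert (by norm_num) (by omega) ?_)
      (inert (by norm_num) (by omega) ?_) <;> unfold Nat.ModEq <;> omega
  have h73 : n % 73 ∈ sums73.map Prod.fst := by
    obtain ⟨p, hp, hpr⟩ := List.mem_map.1 h85
    have h := rel (by norm_num) (by norm_num) (by omega) (by decide) isTable85 (by norm_num)
      (packed_sums85 p hp) hpr.symm
    have key : ∀ p ∈ sums85, ∀ s < 73, 73 ∣ p.2 % 10 ^ 15 + 2 * s * (p.2 / 10 ^ 15) →
      NoRoot 73 s → s ∈ sums73.map Prod.fst := by decide +kernel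
    exact key p hp _ (Nat.mod_lt _ (by norm_num)) h
      (inert (by norm_num) (by omega) (Nat.mod_modEq n 73).symm)
  have h3 : n % 73 = 3 ∨ n % 73 = 70 := by
    obtain ⟨p, hp, hpr⟩ := List.mem_map.1 h73
    have h := rel (by norm_num) (by norm_num) (by omega) (by decide) isTable73 (by norm_num)
      (packed_sums73 p hp) hpr.symm
    have key : ∀ p ∈ sums73, ∀ s < 89, 89 ∣ p.2 % 10 ^ 15 + 2 * s * (p.2 / 10 ^ 15) →
      p.1 = 3 ∨ p.1 = 70 := by decide +kernel
    rw [← hpr]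
    exact key p hp _ (Nat.mod_lt _ (by norm_num)) h
  have h219 : n % 219 ∈ sums219.map Prod.fst := by
    have key : ∀ r < 219, NoRoot 3 r → r % 73 = 3 ∨ r % 73 = 70 → r ∈ sums219.map Prod.fst := by
      decide +kernel
    refine key _ (Nat.mod_lt _ (by norm_num)) (inert (by norm_num) (by omega) ?_) (by omega)
    unfold Nat.ModEq
    omega
  obtain ⟨p, hp, hpr⟩ := List.mem_map.1 h219
  have h := rel (by norm_num) (by norm_num) (by omega) (by decide) isTable219 (by norm_num)
    (packed_sums219 p hp) hpr.symm
  have key : ∀ p ∈ sums219, ∀ s < 37, 37 ∣ p.2 % 10 ^ 15 + 2 * s * (p.2 / 10 ^ 15) →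
    ¬ NoRoot 37 s := by decide +kernel
  exact key p hp _ (Nat.mod_lt _ (by norm_num)) h
    (inert (by norm_num) (by omega) (Nat.mod_modEq n 37).symm)

/-! ### Small norms and class number one -/

section RepresentsNegOne

variable {n : ℕ}

theorem exists_norm_natAbs_eq
    (h : ∀ a b c : ℤ, b ^ 2 - 4 * a * c = (n : ℤ) ^ 2 + 4 →
      ∃ x y : ℤ, a * x ^ 2 + b * x * y + c * y ^ 2 = -1)
    (p : ℕ) (z : ℤ) (hz : (p : ℤ) ∣ z ^ 2 + n * z - 1) :
    ∃ π : Order n, (QuadraticAlgebra.norm π).natAbs = p := by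
  obtain ⟨k, hk⟩ := hz
  obtain ⟨x, y, hxy⟩ := h p (2 * z + n) k (by linear_combination 4 * hk)
  refine ⟨⟨p * x + z * y, y⟩, ?_⟩
  have : QuadraticAlgebra.norm (⟨p * x + z * y, y⟩ : Order n) = -p := by
    rw [norm_eq]
    linear_combination (p : ℤ) * hxy + y ^ 2 * hk
  simp [this]

theorem le_of_norm_natAbs_eq_prime {p : ℕ} (hp : p.Prime) (hn : 0 < n) {π : Order n}
    (hπ : (QuadraticAlgebra.norm π).natAbs = p) : n ≤ p := by
  obtain ⟨⟨X, Y⟩, hz, -⟩ := exists_cone_associated_of_natAbs hn hp.pos hπ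
  obtain ⟨hY, h⟩ := mem_cone.1 hz
  rcases Nat.eq_zero_or_pos Y with rfl | hY0
  · have : p = X ^ 2 := by simpa using h.symm
    exact absurd (this ▸ hp) (Nat.Prime.not_prime_pow le_rfl)
  · have hX : 1 ≤ X := Nat.pos_of_ne_zero fun h0 => by simp [h0] at hY
    obtain ⟨t, ht⟩ := Nat.exists_eq_add_of_lt hY
    have : n * X * Y = Y ^ 2 + Y * (t + 1) := by rw [ht]; ring
    have hnX : n ≤ n * X := Nat.le_mul_of_pos_right n hX
    nlinarith

theorem prime_sq_add_four (hn : Odd n) (hn1 : 1 < n)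
    (hinert : ∀ p : ℕ, p.Prime → p < n → ∀ z : ℤ, ¬ (p : ℤ) ∣ z ^ 2 + n * z - 1) :
    (n ^ 2 + 4).Prime := by
  by_contra hd
  set p := (n ^ 2 + 4).minFac with hp
  have hpp : p.Prime := Nat.minFac_prime (by omega)
  have hpd : p ∣ n ^ 2 + 4 := Nat.minFac_dvd _
  have hsq : p ^ 2 ≤ n ^ 2 + 4 := Nat.minFac_sq_le_self (by omega) hd
  have hodd : Odd p := Odd.of_dvd_nat (hn.pow.add_even (by decide)) hpd
  have hpn : p ≤ n := by nlinarith
  have hne : p ≠ n := by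
    intro h
    rw [h] at hpd
    have h4 : n ∣ 4 := (Nat.dvd_add_right (dvd_pow_self n two_ne_zero)).1 hpd
    have : n ≤ 4 := Nat.le_of_dvd (by norm_num) h4
    interval_cases n <;> revert hn h4 <;> decide
  obtain ⟨m, hm⟩ := hodd
  refine hinert p hpp (by omega) (n * m) ?_
  have h4 : (p : ℤ) ∣ 2 ^ 2 * (((n * m : ℕ) : ℤ) ^ 2 + n * (n * m : ℕ) - 1) := by
    have h1 : (p : ℤ) ∣ (n : ℤ) ^ 2 + 4 := by exact_mod_cast hpd
    have h2 : (2 : ℤ) ^ 2 * (((n * m : ℕ) : ℤ) ^ 2 + n * (n * m : ℕ) - 1) =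
        p * (n ^ 2 * p) - (n ^ 2 + 4) := by
      rw [hm]; push_cast; ring
    rw [h2]
    exact dvd_sub (dvd_mul_right _ _) h1
  have hcop : IsCoprime (p : ℤ) (2 ^ 2) := by
    refine IsCoprime.pow_right ⟨1, -m, ?_⟩
    rw [hm]; push_cast; ring
  exact_mod_cast hcop.dvd_of_dvd_mul_left h4

theorem exists_form_of_odd (hn : Odd n) (h4 : 4 ≤ n)
    (hex : n ≠ 5 ∧ n ≠ 7 ∧ n ≠ 13 ∧ n ≠ 17) :
    ∃ a b c : ℤ, b ^ 2 - 4 * a * c = (n : ℤ) ^ 2 + 4 ∧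
      ∀ x y : ℤ, a * x ^ 2 + b * x * y + c * y ^ 2 ≠ -1 := by
  by_contra! h
  have hroot (p : ℕ) (_ : p.Prime) (z : ℤ) (hz : (p : ℤ) ∣ z ^ 2 + n * z - 1) :=
    exists_norm_natAbs_eq h p z hz
  have hinert (p : ℕ) (hp : p.Prime) (hpn : p < n) (z : ℤ) :
      ¬ (p : ℤ) ∣ z ^ 2 + n * z - 1 := fun hz => by
    obtain ⟨π, hπ⟩ := hroot p hp z hz
    exact hpn.not_ge (le_of_norm_natAbs_eq_prime hp (by omega) hπ)
  rcases le_or_gt n 89 with hle | hgt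
  · have key : ∀ n < 90, Odd n ∧ 4 ≤ n ∧ n ≠ 5 ∧ n ≠ 7 ∧ n ≠ 13 ∧ n ≠ 17 →
        ∃ p < n, p.Prime ∧ ¬ NoRoot p n := by decide +kernel
    obtain ⟨p, hpn, hp, hr⟩ := key n (by omega) ⟨hn, h4, hex⟩
    exact hr (noRoot_mod hp.pos (hinert p hp hpn) rfl)
  · have : Fact (n ^ 2 + 4).Prime := ⟨prime_sq_add_four hn (by omega) hinert⟩
    exact false_of_noRoot hn hgt hroot hinert

end RepresentsNegOne

theorem sq_add_four_ne_sq {α : ℤ} (hα : 0 < α) (s : ℤ) : α ^ 2 + 4 ≠ s ^ 2 := by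
  intro h
  rw [← sq_abs s] at h
  have h1 : α < |s| := by nlinarith [abs_nonneg s]
  have h2 : |s| < α + 2 := by nlinarith [abs_nonneg s]
  have h3 : |s| = α + 1 := by omega
  rw [h3] at h
  have : 2 * α = 3 := by linarith
  omega

theorem form_ne_zero {α β a b c : ℤ} (hα : 0 < α)
    (h : β ^ 2 * (b ^ 2 - 4 * a * c) = α ^ 2 + 4) {x y : ℤ} (hxy : (x, y) ≠ (0, 0)) :
    a * x ^ 2 + b * x * y + c * y ^ 2 ≠ 0 := by
  intro h0
  rcases eq_or_ne y 0 with rfl | hy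
  · have hx : x ≠ 0 := fun hx => hxy (by rw [hx])
    have ha : a = 0 := by simpa [hx] using h0
    exact sq_add_four_ne_sq hα (β * b) (by rw [← h, ha]; ring)
  · have ht : (α ^ 2 + 4) * y ^ 2 = (β * (2 * a * x + b * y)) ^ 2 := by
      linear_combination -y ^ 2 * h - 4 * a * β ^ 2 * h0
    obtain ⟨s, hs⟩ := (Int.pow_dvd_pow_iff two_ne_zero).1 (Dvd.intro_left _ ht)
    rw [hs, mul_pow, mul_comm] at ht
    exact sq_add_four_ne_sq hα s (mul_left_cancel₀ (pow_ne_zero 2 hy) ht)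

theorem sq_sub_ne_two {k : ℕ} (hk : 2 ≤ k) :
    ∀ Y X : ℕ, (X : ℤ) ^ 2 - (k ^ 2 + 1) * (Y : ℤ) ^ 2 ≠ 2 ∧
      (X : ℤ) ^ 2 - (k ^ 2 + 1) * (Y : ℤ) ^ 2 ≠ -2 := by
  intro Y
  induction Y using Nat.strong_induction_on with
  | _ Y ih =>
    intro X
    have hk' : (2 : ℤ) ≤ k := by exact_mod_cast hk
    rcases Nat.eq_zero_or_pos Y with rfl | hY
    · have : X ^ 2 ≠ 2 := fun h => by
        have : X < 2 := by nlinarith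
        interval_cases X <;> omega
      have h2 : ((X : ℤ)) ^ 2 ≠ 2 := by exact_mod_cast this
      refine ⟨by simpa using h2, ?_⟩
      have := sq_nonneg (X : ℤ)
      simp only [Nat.cast_zero]
      omega
    · have hY' : (1 : ℤ) ≤ Y := by exact_mod_cast hY
      have hX : (0 : ℤ) ≤ X := by positivity
      have step (h : |(X : ℤ) ^ 2 - (k ^ 2 + 1) * (Y : ℤ) ^ 2| ≤ 2) :
          ((X : ℤ) - k * Y).natAbs < Y := by
        obtain ⟨h1, h2⟩ := abs_le.1 h
        have h3 : (X : ℤ) < (k + 1) * Y := by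
          refine lt_of_pow_lt_pow_left₀ 2 (by positivity) ?_
          nlinarith
        have h4 : ((k : ℤ) - 1) * Y < X := by
          refine lt_of_pow_lt_pow_left₀ 2 hX ?_
          nlinarith
        zify
        rw [abs_lt]
        constructor <;> linarith
      have hcong : ((((k ^ 2 + 1) * Y - k * X : ℤ).natAbs : ℤ)) ^ 2 -
          (k ^ 2 + 1) * ((((X : ℤ) - k * Y).natAbs : ℤ)) ^ 2 =
          -((X : ℤ) ^ 2 - (k ^ 2 + 1) * (Y : ℤ) ^ 2) := by
        simp only [Int.natCast_natAbs, sq_abs]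
        ring
      constructor
      · intro h
        exact (ih _ (step (by rw [h]; norm_num)) _).2 (hcong.trans (by rw [h]))
      · intro h
        exact (ih _ (step (by rw [h]; norm_num)) _).1 (hcong.trans (by rw [h]; norm_num))

theorem exists_form_of_even {k : ℕ} (hk : 2 ≤ k) :
    ∃ a b c : ℤ, b ^ 2 - 4 * a * c = (2 * k : ℤ) ^ 2 + 4 ∧
      ∀ x y : ℤ, a * x ^ 2 + b * x * y + c * y ^ 2 ≠ -1 := by
  rcases Nat.even_or_odd' k with ⟨j, rfl | rfl⟩
  · refine ⟨2, 2, -2 * j ^ 2, by push_cast; ring, fun x y h => ?_⟩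
    have : 2 * (x ^ 2 + x * y - j ^ 2 * y ^ 2) = -1 := by linear_combination h
    omega
  · refine ⟨2, 0, -(2 * j ^ 2 + 2 * j + 1), by push_cast; ring, fun x y h => ?_⟩
    refine (sq_sub_ne_two hk y.natAbs (2 * x).natAbs).2 ?_
    simp only [Int.natCast_natAbs, sq_abs]
    push_cast
    linear_combination 2 * h

theorem represents_neg_one_of_minimal {α : ℕ} (hα : α ∈ [1, 2, 3, 5, 7, 13, 17]) {a b c : ℤ}
    (h : b ^ 2 - 4 * a * c = (α : ℤ) ^ 2 + 4) (hba : |b| ≤ |a|) (hac : |a| ≤ |c|) :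
    ∃ x y : ℤ, a * x ^ 2 + b * x * y + c * y ^ 2 = -1 := by
  have hα17 : α ≤ 17 := (by decide : ∀ α ∈ [1, 2, 3, 5, 7, 13, 17], α ≤ 17) α hα
  have hα1 : 1 ≤ α := (by decide : ∀ α ∈ [1, 2, 3, 5, 7, 13, 17], 1 ≤ α) α hα
  have hb2 : b ^ 2 ≤ a ^ 2 := sq_le_sq.2 hba
  have hneg : a * c ≤ 0 := by
    by_contra! hpos
    have : |a| * |c| = a * c := by rw [← abs_mul, abs_of_pos hpos]
    nlinarith [sq_abs a, abs_nonneg a]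
  have hmul : |a| * |c| = -(a * c) := by rw [← abs_mul, abs_of_nonpos hneg]
  have hN : b.natAbs ^ 2 + 4 * a.natAbs * c.natAbs = α ^ 2 + 4 := by
    zify
    rw [sq_abs]
    linear_combination h + 4 * hmul
  have hbaN : b.natAbs ≤ a.natAbs := by zify; exact hba
  have hacN : a.natAbs ≤ c.natAbs := by zify; exact hac
  have ha9 : a.natAbs < 9 := by nlinarith
  have key : ∀ α ∈ [1, 2, 3, 5, 7, 13, 17], ∀ A < 9, ∀ B < 9,
      A ≤ (α ^ 2 + 4 - B ^ 2) / (4 * A) ∧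
      4 * A * ((α ^ 2 + 4 - B ^ 2) / (4 * A)) = α ^ 2 + 4 - B ^ 2 ∧
      B ≤ A → A = 1 := by decide +kernel
  have ha0 : 0 < a.natAbs := by
    rw [Int.natAbs_pos]
    rintro rfl
    have hb : b = 0 := by simpa using hba
    rw [hb] at h
    nlinarith
  have hsub : α ^ 2 + 4 - b.natAbs ^ 2 = 4 * a.natAbs * c.natAbs := by omega
  have hA := key α hα a.natAbs ha9 b.natAbs (by omega) (by
    rw [hsub, Nat.mul_div_cancel_left _ (by omega)]
    exact ⟨hacN, rfl, hbaN⟩)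
  rcases Int.natAbs_eq_iff.1 hA with rfl | rfl
  · have hpar : Even ((α : ℤ) - b) := by
      have : Even ((α : ℤ) ^ 2 - b ^ 2) := ⟨-2 * c - 2, by linear_combination -h⟩
      rw [Int.even_sub] at this ⊢
      simpa [Int.even_pow] using this
    obtain ⟨x, hx⟩ := hpar
    refine ⟨x, 1, ?_⟩
    push_cast at h ⊢
    have hx' : (α : ℤ) = 2 * x + b := by linarith
    rw [hx'] at h
    linarith
  · exact ⟨1, 0, by norm_num⟩

theorem represents_neg_one {α : ℕ} (hα : α ∈ [1, 2, 3, 5, 7, 13, 17]) (N : ℕ) :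
    ∀ a b c : ℤ, a.natAbs = N → b ^ 2 - 4 * a * c = (α : ℤ) ^ 2 + 4 →
      ∃ x y : ℤ, a * x ^ 2 + b * x * y + c * y ^ 2 = -1 := by
  induction N using Nat.strong_induction_on with
  | _ N ih =>
    intro a b c hN h
    have hα1 : (0 : ℤ) < α := by
      exact_mod_cast (by decide : ∀ α ∈ [1, 2, 3, 5, 7, 13, 17], 0 < α) α hα
    have ha : a ≠ 0 := by
      rintro rfl
      exact sq_add_four_ne_sq hα1 b (by rw [← h]; ring)
    obtain ⟨t, ht⟩ : ∃ t, |b + 2 * a * t| ≤ |a| := by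
      refine ⟨-((b + |a|) / (2 * |a|)) * a.sign, ?_⟩
      have h1 := Int.emod_add_mul_ediv (b + |a|) (2 * |a|)
      have ha' : 0 < 2 * |a| := by positivity
      have h2 := Int.emod_nonneg (b + |a|) ha'.ne'
      have h3 := Int.emod_lt_of_pos (b + |a|) ha'
      have h4 : 2 * a * (-((b + |a|) / (2 * |a|)) * a.sign) =
          -(2 * |a| * ((b + |a|) / (2 * |a|))) := by
        rw [← Int.sign_mul_self_eq_abs a]
        ring
      rw [h4, abs_le]
      constructor <;> linarith
    have h' : (b + 2 * a * t) ^ 2 - 4 * a * (a * t ^ 2 + b * t + c) = (α : ℤ) ^ 2 + 4 := by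
      linear_combination h
    have back {x y : ℤ}
        (hxy : a * x ^ 2 + (b + 2 * a * t) * x * y + (a * t ^ 2 + b * t + c) * y ^ 2 = -1) :
        ∃ x y : ℤ, a * x ^ 2 + b * x * y + c * y ^ 2 = -1 :=
      ⟨x + t * y, y, by linear_combination hxy⟩
    rcases le_or_gt |a| |a * t ^ 2 + b * t + c| with hac | hac
    · obtain ⟨x, y, hxy⟩ := represents_neg_one_of_minimal hα h' ht hac
      exact back hxy
    · obtain ⟨x, y, hxy⟩ := ih _ (by zify; rw [← hN]; zify; exact hac) _ (b + 2 * a * t) a rfl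
        (by linear_combination h')
      exact back (x := y) (y := x) (by linear_combination hxy)

end Yokoi

/-- Anti-symplectic case of Main Theorem: `A₋₁ = ℤ_{≥4} \ {5, 7, 13, 17}`. -/
theorem stmt11 (α : ℤ) (hα : 0 < α) :
    (4 ≤ α ∧ α ≠ 5 ∧ α ≠ 7 ∧ α ≠ 13 ∧ α ≠ 17) ↔
      ∃ β : ℤ, 0 < β ∧ ∃ a b c : ℤ,
        β ^ 2 * (b ^ 2 - 4 * a * c) = α ^ 2 + 4 ∧
        ∀ x y : ℤ, (x, y) ≠ (0, 0) →
          2 * a * x ^ 2 + 2 * b * x * y + 2 * c * y ^ 2 ≠ 0 ∧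
            2 * a * x ^ 2 + 2 * b * x * y + 2 * c * y ^ 2 ≠ -2 := by
  lift α to ℕ using hα.le
  constructor
  · rintro ⟨h4, hex⟩
    obtain ⟨a, b, c, h, hneg⟩ : ∃ a b c : ℤ, b ^ 2 - 4 * a * c = (α : ℤ) ^ 2 + 4 ∧
        ∀ x y : ℤ, a * x ^ 2 + b * x * y + c * y ^ 2 ≠ -1 := by
      rcases Nat.even_or_odd α with he | ho
      · obtain ⟨k, rfl⟩ := even_iff_two_dvd.1 he
        push_cast at h4 ⊢
        exact Yokoi.exists_form_of_even (by omega)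
      · exact Yokoi.exists_form_of_odd ho (by omega) (by omega)
    refine ⟨1, one_pos, a, b, c, by rw [h]; ring, fun x y hxy => ⟨fun h0 => ?_, fun h2 => ?_⟩⟩
    · exact Yokoi.form_ne_zero (β := 1) hα (by rw [h]; ring) hxy (by linarith)
    · exact hneg x y (by linarith)
  · rintro ⟨β, hβ, a, b, c, h, hform⟩
    by_contra hex
    have hmem : α ∈ [1, 2, 3, 5, 7, 13, 17] := by
      simp only [List.mem_cons, List.not_mem_nil]
      omega
    have hβ1 : b ^ 2 - 4 * a * c = (α : ℤ) ^ 2 + 4 := by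
      lift β to ℕ using hβ.le
      have hβ17 : β < 18 := by
        have h17 : α ≤ 17 := (by decide : ∀ α ∈ [1, 2, 3, 5, 7, 13, 17], α ≤ 17) α hmem
        have : 1 ≤ b ^ 2 - 4 * a * c := by
          by_contra! hlt
          nlinarith [mul_nonneg (sq_nonneg (β : ℤ)) (by linarith : 0 ≤ -(b ^ 2 - 4 * a * c))]
        have h17' : (α : ℤ) ≤ 17 := by exact_mod_cast h17
        zify
        nlinarith
      have key : ∀ α ∈ [1, 2, 3, 5, 7, 13, 17], ∀ β < 18,
          β ^ 2 ∣ α ^ 2 + 4 → β = 1 ∨ α = 2 ∧ β = 2 := by decide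
      rcases key α hmem β hβ17 (by zify; exact Dvd.intro _ h) with rfl | ⟨rfl, rfl⟩
      · simpa using h
      · exfalso
        push_cast at h
        have h2 : b ^ 2 = 4 * (a * c) + 2 := by linarith
        rcases Int.even_or_odd' b with ⟨m, rfl | rfl⟩
        · have : 4 * (m ^ 2 - a * c) = 2 := by linear_combination h2
          omega
        · have : 4 * (m ^ 2 + m - a * c) = 1 := by linear_combination h2
          omega
    obtain ⟨x, y, hxy⟩ := Yokoi.represents_neg_one hmem _ a b c rfl hβ1
    refine (hform x y fun h0 => ?_).2 (by linarith)
    obtain ⟨rfl, rfl⟩ := Prod.mk.inj h0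
    norm_num at hxy
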